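/- arXiv:2403.13224 — 2 statements merged into one kernel-verified Lean document; each statement's English description precedes it below -/
import Mathlib

section
/- Let n ≥ 1 and let u ∈ ℝ^{n+1} be a unit vector. Then the pushforward of P under the map z ↦ Σ_j u_j·(z_j − 1) admits a density f with respect to Lebesgue measure on ℝ such that f is continuous at 0 and f(0) ≥ 1/e. Moreover, if u = (1, 0, 0, …, 0), then every density of this pushforward that is continuous at 0 satisfies f(0) = 1/e. -/
open MeasureTheory ProbabilityTheory

/-- The product of `n+1` i.i.d. standard exponential distributions on `ℝ^{n+1}`. -/
noncomputable def expProd (n : ℕ) : Measure (Fin (n + 1) → ℝ) :=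
  Measure.pi fun _ => expMeasure 1

section Contour

open Complex Filter Topology Set

variable {ι : Type*} [Fintype ι]

/-- The logarithm of the moment generating function of `∑ j, u j * (Z j - 1) + √ε G`, where the
`Z j` are standard exponential and `G` is standard Gaussian, all independent. -/
noncomputable def smoothedCGF (ε : ℝ) (u : ι → ℝ) (s : ℂ) : ℂ :=
  ε * s ^ 2 / 2 + ∑ j, (-(u j * s) - log (1 - u j * s))

/-- The derivative of `smoothedCGF`. -/
noncomputable def smoothedCGFDeriv (ε : ℝ) (u : ι → ℝ) (s : ℂ) : ℂ :=
  s * (ε + ∑ j, (u j : ℂ) ^ 2 / (1 - u j * s))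

lemma one_sub_mul_mem_slitPlane (u : ℝ) {s : ℂ} (hs : s.im ≠ 0 ∨ s = 0) :
    1 - u * s ∈ slitPlane := by
  rcases hs with hs | rfl
  · by_cases hu : u = 0
    · simp [hu]
    · refine Or.inr ?_
      simp [hu, hs]
  · simp

lemma hasDerivAt_smoothedCGF (ε : ℝ) (u : ι → ℝ) {s : ℂ} (hs : s.im ≠ 0 ∨ s = 0) :
    HasDerivAt (smoothedCGF ε u) (smoothedCGFDeriv ε u s) s := by
  have hj (j : ι) : HasDerivAt (fun z : ℂ ↦ -(u j * z) - log (1 - u j * z))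
      (-(u j) - -(u j) / (1 - u j * s)) s := by
    have h1 : HasDerivAt (fun z : ℂ ↦ (u j : ℂ) * z) (u j) s := by
      simpa using (hasDerivAt_id s).const_mul (u j : ℂ)
    exact h1.neg.sub ((h1.const_sub 1).clog (one_sub_mul_mem_slitPlane (u j) hs))
  have h2 : HasDerivAt (fun z : ℂ ↦ (ε : ℂ) * z ^ 2 / 2) (ε * s) s := by
    have := (((hasDerivAt_id s).pow 2).const_mul (ε : ℂ)).div_const 2
    convert! this using 1
    simp; ring
  convert! h2.add (HasDerivAt.fun_sum fun j _ ↦ hj j) using 1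
  rw [smoothedCGFDeriv, mul_add, Finset.mul_sum, mul_comm s]
  congr 1
  refine Finset.sum_congr rfl fun j _ ↦ ?_
  have := slitPlane_ne_zero (one_sub_mul_mem_slitPlane (u j) hs)
  rw [← mul_div_assoc, eq_sub_iff_add_eq, ← add_div, div_eq_iff this]
  ring

lemma im_div_one_sub_mul (u : ℝ) (s : ℂ) :
    (s / (1 - u * s)).im = s.im / normSq (1 - u * s) := by
  rw [div_im]
  simp
  ring

lemma smoothedCGFDeriv_eq (ε : ℝ) (u : ι → ℝ) (s : ℂ) :
    smoothedCGFDeriv ε u s = ε * s + ∑ j, ((u j ^ 2 : ℝ) : ℂ) * (s / (1 - u j * s)) := by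
  rw [smoothedCGFDeriv, mul_add, Finset.mul_sum, mul_comm s]
  congr 1
  refine Finset.sum_congr rfl fun j _ ↦ ?_
  push_cast
  ring

lemma im_smoothedCGFDeriv (ε : ℝ) (u : ι → ℝ) (s : ℂ) :
    (smoothedCGFDeriv ε u s).im = ε * s.im + ∑ j, u j ^ 2 * (s.im / normSq (1 - u j * s)) := by
  rw [smoothedCGFDeriv_eq, add_im, im_sum, im_ofReal_mul]
  simp_rw [im_ofReal_mul, im_div_one_sub_mul]

lemma im_smoothedCGFDeriv_pos {ε : ℝ} (hε : 0 < ε) (u : ι → ℝ) {s : ℂ} (hs : 0 < s.im) :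
    0 < (smoothedCGFDeriv ε u s).im := by
  rw [im_smoothedCGFDeriv]
  have : 0 ≤ ∑ j, u j ^ 2 * (s.im / normSq (1 - u j * s)) :=
    Finset.sum_nonneg fun j _ ↦ mul_nonneg (sq_nonneg _) (div_nonneg hs.le (normSq_nonneg _))
  positivity

/-- The values of `smoothedCGFDeriv` lie in a disc tangent to the real axis. -/
lemma normSq_smoothedCGFDeriv_le {ε : ℝ} (hε : 0 < ε) {u : ι → ℝ} (hu : ∑ j, u j ^ 2 = 1) {s : ℂ}
    (hs : 0 < s.im) :
    normSq (smoothedCGFDeriv ε u s) * s.im ≤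
      (1 + ε) * normSq s * (smoothedCGFDeriv ε u s).im := by
  have hnorm : ‖smoothedCGFDeriv ε u s‖ ≤ ε * ‖s‖ + ∑ j, u j ^ 2 * ‖s / (1 - u j * s)‖ := by
    rw [smoothedCGFDeriv_eq]
    refine (norm_add_le _ _).trans (add_le_add ?_ ((norm_sum_le _ _).trans ?_))
    · simp [abs_of_pos hε]
    · refine Finset.sum_le_sum fun j _ ↦ ?_
      rw [norm_mul, norm_real, Real.norm_of_nonneg (sq_nonneg _)]
  have hcs : (ε * ‖s‖ + ∑ j, u j ^ 2 * ‖s / (1 - u j * s)‖) ^ 2 ≤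
      (1 + ε) * (ε * ‖s‖ ^ 2 + ∑ j, u j ^ 2 * ‖s / (1 - u j * s)‖ ^ 2) := by
    have h1 : (∑ j, u j ^ 2 * ‖s / (1 - u j * s)‖) ^ 2 ≤
        ∑ j, u j ^ 2 * ‖s / (1 - u j * s)‖ ^ 2 := by
      have := Finset.sum_sq_le_sum_mul_sum_of_sq_le_mul Finset.univ
        (r := fun j ↦ u j ^ 2 * ‖s / (1 - u j * s)‖) (f := fun j ↦ u j ^ 2)
        (g := fun j ↦ u j ^ 2 * ‖s / (1 - u j * s)‖ ^ 2)
        (fun j _ ↦ by positivity) (fun j _ ↦ by positivity) (fun j _ ↦ le_of_eq (by ring))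
      simpa [hu] using this
    nlinarith [mul_nonneg hε.le (sq_nonneg (‖s‖ - ∑ j, u j ^ 2 * ‖s / (1 - u j * s)‖))]
  have him : (ε * ‖s‖ ^ 2 + ∑ j, u j ^ 2 * ‖s / (1 - u j * s)‖ ^ 2) * s.im =
      normSq s * (smoothedCGFDeriv ε u s).im := by
    rw [im_smoothedCGFDeriv, add_mul, mul_add, Finset.sum_mul, Finset.mul_sum]
    congr 1
    · rw [normSq_eq_norm_sq]; ring
    · refine Finset.sum_congr rfl fun j _ ↦ ?_
      rw [norm_div, div_pow, normSq_eq_norm_sq, normSq_eq_norm_sq]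
      ring
  calc normSq (smoothedCGFDeriv ε u s) * s.im
      ≤ (1 + ε) * (ε * ‖s‖ ^ 2 + ∑ j, u j ^ 2 * ‖s / (1 - u j * s)‖ ^ 2) * s.im := by
        rw [normSq_eq_norm_sq]
        gcongr
        exact (pow_le_pow_left₀ (norm_nonneg _) hnorm 2).trans hcs
    _ = _ := by rw [mul_assoc, him, mul_assoc]

lemma continuousAt_smoothedCGFDeriv (ε : ℝ) (u : ι → ℝ) {s : ℂ} (hs : s.im ≠ 0) :
    ContinuousAt (smoothedCGFDeriv ε u) s := by
  unfold smoothedCGFDeriv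
  have (j : ι) := slitPlane_ne_zero (one_sub_mul_mem_slitPlane (u j) (Or.inl hs))
  fun_prop (disch := simp [this])

/-- The real part, at height `y`, of the steepest descent curve of a single centred exponential. -/
noncomputable def expCurve (y : ℝ) : ℝ := 1 - y * Real.cos y / Real.sin y

lemma nonneg_of_unimodal {b r : ℝ → ℝ} {p q : ℝ} (hp : 0 ≤ p) (hq : 0 < q) (hr : ∀ t, 0 ≤ r t)
    (hb : ∀ t, HasDerivAt b (t * (p - t * q) * r t) t) (h0 : b 0 = 0) (h1 : b 1 = 0) {t : ℝ}
    (ht1 : t ≤ 1) : 0 ≤ b t := by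
  have hc : Continuous b := continuous_iff_continuousAt.2 fun t ↦ (hb t).continuousAt
  have hd : Differentiable ℝ b := fun t ↦ (hb t).differentiableAt
  rcases le_total t 0 with h | h
  · have : AntitoneOn b (Iic 0) := by
      refine antitoneOn_of_deriv_nonpos (convex_Iic 0) hc.continuousOn hd.differentiableOn ?_
      intro x hx
      rw [interior_Iic] at hx
      rw [(hb x).deriv]
      refine mul_nonpos_of_nonpos_of_nonneg (mul_nonpos_of_nonpos_of_nonneg hx.out.le ?_) (hr x)
      nlinarith [hx.out]
    simpa [h0] using this h (mem_Iic.2 le_rfl) h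
  rcases le_total t (p / q) with h' | h'
  · have : MonotoneOn b (Icc 0 (p / q)) := by
      refine monotoneOn_of_deriv_nonneg (convex_Icc _ _) hc.continuousOn hd.differentiableOn ?_
      intro x hx
      rw [interior_Icc] at hx
      rw [(hb x).deriv]
      have : x * q < p := (lt_div_iff₀ hq).1 hx.2
      exact mul_nonneg (mul_nonneg hx.1.le (by linarith)) (hr x)
    simpa [h0] using this ⟨le_rfl, by positivity⟩ ⟨h, h'⟩ h
  · have : AntitoneOn b (Ici (p / q)) := by
      refine antitoneOn_of_deriv_nonpos (convex_Ici _) hc.continuousOn hd.differentiableOn ?_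
      intro x hx
      rw [interior_Ici] at hx
      rw [(hb x).deriv]
      have h2 : p < x * q := (div_lt_iff₀ hq).1 hx
      have h3 : 0 ≤ x := (div_nonneg hp hq.le).trans hx.out.le
      exact mul_nonpos_of_nonpos_of_nonneg (mul_nonpos_of_nonneg_of_nonpos h3 (by linarith)) (hr x)
    simpa [h1] using this h' (h'.trans ht1) ht1

lemma expCurve_nonneg {y : ℝ} (hy : 0 < y) (hy' : y < Real.pi) : 0 ≤ expCurve y := by
  have hs := Real.sin_pos_of_pos_of_lt_pi hy hy'
  rw [expCurve, sub_nonneg, div_le_one hs]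
  rcases lt_or_ge y (Real.pi / 2) with h | h
  · have hc : 0 < Real.cos y := Real.cos_pos_of_mem_Ioo ⟨by linarith, h⟩
    have := Real.le_tan hy.le h
    rwa [Real.tan_eq_sin_div_cos, le_div_iff₀ hc] at this
  · have : Real.cos y ≤ 0 := Real.cos_nonpos_of_pi_div_two_le_of_le h (by linarith)
    nlinarith

lemma one_sub_expCurve {y : ℝ} (hy : 0 < y) (hy' : y < Real.pi) :
    1 - ((expCurve y : ℂ) + y * I) =
      ((y / Real.sin y : ℝ) : ℂ) * (cos ((-y : ℝ) : ℂ) + sin ((-y : ℝ) : ℂ) * I) := by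
  have hs := (Real.sin_pos_of_pos_of_lt_pi hy hy').ne'
  have hs' : sin (y : ℂ) ≠ 0 := by exact_mod_cast hs
  rw [expCurve]
  push_cast
  rw [cos_neg, sin_neg]
  field_simp
  ring

lemma im_exp_cgf_expCurve_nonneg {y : ℝ} (hy : 0 < y) (hy' : y < Real.pi) {u : ℝ} (hu : u ≤ 1) :
    0 ≤ (-(u * ((expCurve y : ℂ) + y * I)) - log (1 - u * ((expCurve y : ℂ) + y * I))).im := by
  set s : ℂ := (expCurve y : ℂ) + y * I with hs
  have him : s.im = y := by simp [hs]
  have hre : s.re = expCurve y := by simp [hs]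
  have hs0 : s.im ≠ 0 := by rw [him]; exact hy.ne'
  refine nonneg_of_unimodal (b := fun t : ℝ ↦ (-(t * s) - log (1 - t * s)).im)
    (r := fun t ↦ (normSq (1 - t * s))⁻¹) (p := 2 * expCurve y * y) (q := normSq s * y)
    (by have := expCurve_nonneg hy hy'; positivity)
    (mul_pos (normSq_pos.2 (fun h ↦ hs0 (by simp [h]))) hy)
    (fun t ↦ inv_nonneg.2 (normSq_nonneg _)) (fun t ↦ ?_) (by simp) ?_ hu
  · have h1 : HasDerivAt (fun t : ℝ ↦ (t : ℂ) * s) s t := by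
      simpa using (hasDerivAt_id t).ofReal_comp.mul_const s
    have h2 := h1.neg.sub ((h1.const_sub 1).clog_real (one_sub_mul_mem_slitPlane t (Or.inl hs0)))
    have h3 := imCLM.hasFDerivAt.comp_hasDerivAt t h2
    convert! h3 using 1
    have h0 := slitPlane_ne_zero (one_sub_mul_mem_slitPlane t (Or.inl hs0))
    have : -s - -s / (1 - t * s) = t * s ^ 2 / (1 - t * s) := by
      rw [eq_comm, eq_sub_iff_add_eq, ← add_div, div_eq_iff h0]
      ring
    rw [imCLM_apply, this, div_im]
    simp only [normSq_apply, sub_re, sub_im, mul_re, mul_im, one_re, one_im, ofReal_re, ofReal_im,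
      pow_two, him, hre]
    ring
  · have h := one_sub_expCurve hy hy'
    have hpos : 0 < y / Real.sin y := div_pos hy (Real.sin_pos_of_pos_of_lt_pi hy hy')
    simp only [ofReal_one, one_mul, sub_im, neg_im, log_im]
    rw [him, hs, h, arg_mul_cos_add_sin_mul_I hpos ⟨by linarith, by linarith⟩]
    simp

lemma log_one_sub_mul_neg_conj (u : ℝ) {s : ℂ} (hs : s.im ≠ 0) :
    (-(u * -(starRingEnd ℂ) s) - log (1 - u * -(starRingEnd ℂ) s)).im =
      -(-((-u : ℝ) * s) - log (1 - (-u : ℝ) * s)).im := by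
  have h : 1 - u * -(starRingEnd ℂ) s = (starRingEnd ℂ) (1 - (-u : ℝ) * s) := by simp
  rw [h, log_conj _ (slitPlane_arg_ne_pi (one_sub_mul_mem_slitPlane (-u) (Or.inl hs)))]
  simp
  ring

lemma im_smoothedCGF (ε : ℝ) (u : ι → ℝ) (x y : ℝ) :
    (smoothedCGF ε u (x + y * I)).im =
      ε * (x * y) + ∑ j, (-(u j * ((x : ℂ) + y * I)) - log (1 - u j * (x + y * I))).im := by
  rw [smoothedCGF, add_im, im_sum]
  congr 1
  have : (ε : ℂ) * (x + y * I) ^ 2 / 2 =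
      ((ε * (x ^ 2 - y ^ 2) / 2 : ℝ) : ℂ) + ((ε * (x * y) : ℝ) : ℂ) * I := by
    push_cast
    ring_nf
    rw [I_sq]
    ring
  rw [this, add_im, ofReal_im, zero_add, im_ofReal_mul, I_im, mul_one]

lemma im_smoothedCGF_expCurve_nonneg {ε : ℝ} (hε : 0 < ε) {u : ι → ℝ} (hu : ∀ j, |u j| ≤ 1)
    {y : ℝ} (hy : 0 < y) (hy' : y < Real.pi) :
    0 ≤ (smoothedCGF ε u (expCurve y + y * I)).im := by
  rw [im_smoothedCGF]
  have := expCurve_nonneg hy hy'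
  have := Finset.sum_nonneg fun j (_ : j ∈ Finset.univ) ↦
    im_exp_cgf_expCurve_nonneg hy hy' (le_of_abs_le (hu j))
  positivity

lemma im_smoothedCGF_neg_expCurve_nonpos {ε : ℝ} (hε : 0 < ε) {u : ι → ℝ} (hu : ∀ j, |u j| ≤ 1)
    {y : ℝ} (hy : 0 < y) (hy' : y < Real.pi) :
    (smoothedCGF ε u ((-expCurve y : ℝ) + y * I)).im ≤ 0 := by
  rw [im_smoothedCGF]
  have h0 := expCurve_nonneg hy hy'
  have h1 : ((-expCurve y : ℝ) : ℂ) + y * I = -(starRingEnd ℂ) ((expCurve y : ℂ) + y * I) := by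
    simp; ring
  rw [h1]
  have h2 : ∀ j ∈ Finset.univ, (-(u j * -(starRingEnd ℂ) ((expCurve y : ℂ) + y * I)) -
      log (1 - u j * -(starRingEnd ℂ) ((expCurve y : ℂ) + y * I))).im ≤ 0 := fun j _ ↦ by
    rw [log_one_sub_mul_neg_conj _ (by simpa using hy.ne'), neg_nonpos]
    exact im_exp_cgf_expCurve_nonneg hy hy' ((neg_le_abs _).trans (hu j))
  have h3 := Finset.sum_nonpos h2
  have h4 : 0 ≤ ε * (expCurve y * y) := by positivity
  linarith [show ε * (-expCurve y * y) = -(ε * (expCurve y * y)) by ring]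

lemma hasDerivAt_comp_curve {f : ℂ → ℂ} {f' : ℂ} {x : ℝ → ℝ} {x' y : ℝ}
    (hf : HasDerivAt f f' (x y + y * I)) (hx : HasDerivAt x x' y) :
    HasDerivAt (fun t : ℝ ↦ f (x t + t * I)) (f' * (x' + I)) y := by
  have h : HasDerivAt (fun t : ℝ ↦ (x t : ℂ) + t * I) (x' + 1 * I) y :=
    hx.ofReal_comp.add ((hasDerivAt_id y).ofReal_comp.mul_const I)
  rw [one_mul] at h
  exact hf.comp y h

lemma hasDerivAt_im_smoothedCGF_horizontal (ε : ℝ) (u : ι → ℝ) {y : ℝ} (hy : 0 < y) (x : ℝ) :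
    HasDerivAt (fun x : ℝ ↦ (smoothedCGF ε u (x + y * I)).im)
      (smoothedCGFDeriv ε u (x + y * I)).im x := by
  have h : HasDerivAt (fun t : ℝ ↦ (t : ℂ) + y * I) 1 x := by
    simpa using (hasDerivAt_id x).ofReal_comp.add_const (y * I)
  have h1 : HasDerivAt (smoothedCGF ε u) (smoothedCGFDeriv ε u (x + y * I)) (x + y * I) :=
    hasDerivAt_smoothedCGF ε u (Or.inl (by simpa using hy.ne'))
  have h2 := h1.comp x h
  rw [mul_one] at h2
  exact imCLM.hasFDerivAt.comp_hasDerivAt x h2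

lemma strictMono_im_smoothedCGF {ε : ℝ} (hε : 0 < ε) (u : ι → ℝ) {y : ℝ} (hy : 0 < y) :
    StrictMono fun x : ℝ ↦ (smoothedCGF ε u (x + y * I)).im := by
  refine strictMono_of_deriv_pos fun x ↦ ?_
  rw [(hasDerivAt_im_smoothedCGF_horizontal ε u hy x).deriv]
  exact im_smoothedCGFDeriv_pos hε u (by simpa using hy)

lemma abs_im_smoothedCGF_sub_le (ε : ℝ) {u : ι → ℝ} (hu : ∀ j, |u j| ≤ 1) (x : ℝ) {y : ℝ}
    (hy : 0 < y) :
    |(smoothedCGF ε u (x + y * I)).im - ε * (x * y)| ≤ Fintype.card ι * (y + Real.pi) := by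
  rw [im_smoothedCGF, add_sub_cancel_left]
  refine (Finset.abs_sum_le_sum_abs _ _).trans ?_
  rw [← nsmul_eq_mul, ← Finset.card_univ]
  refine Finset.sum_le_card_nsmul _ _ _ fun j _ ↦ ?_
  rw [sub_im, neg_im, log_im, im_ofReal_mul]
  refine (abs_sub _ _).trans (add_le_add ?_ (abs_arg_le_pi _))
  rw [abs_neg, abs_mul]
  simpa [abs_of_pos hy] using mul_le_mul_of_nonneg_right (hu j) hy.le

/-- The steepest descent curve of `smoothedCGF` through the origin. -/
lemma exists_im_smoothedCGF_eq_zero {ε : ℝ} (hε : 0 < ε) {u : ι → ℝ} (hu : ∀ j, |u j| ≤ 1)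
    {y : ℝ} (hy : 0 < y) :
    ∃ x : ℝ, (smoothedCGF ε u (x + y * I)).im = 0 ∧
      |x| ≤ Fintype.card ι * (y + Real.pi) / (ε * y) ∧ (y < Real.pi → |x| ≤ expCurve y) := by
  set R : ℝ := Fintype.card ι * (y + Real.pi) / (ε * y) with hR
  have hεy : 0 < ε * y := by positivity
  have hR0 : 0 ≤ R := by have := Real.pi_pos; positivity
  have hRm : ε * (R * y) = Fintype.card ι * (y + Real.pi) := by rw [hR]; field_simp
  have hmono := strictMono_im_smoothedCGF hε u hy
  have hcont : Continuous fun x : ℝ ↦ (smoothedCGF ε u (x + y * I)).im :=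
    continuous_iff_continuousAt.2 fun x ↦
      (hasDerivAt_im_smoothedCGF_horizontal ε u hy x).continuousAt
  have h1 := abs_le.1 (abs_im_smoothedCGF_sub_le ε hu R hy)
  have h2 := abs_le.1 (abs_im_smoothedCGF_sub_le ε hu (-R) hy)
  obtain ⟨x, hx, hx0⟩ := intermediate_value_Icc (by linarith : -R ≤ R) hcont.continuousOn
    (show (0 : ℝ) ∈ Icc _ _ from ⟨by linarith, by linarith⟩)
  refine ⟨x, hx0, abs_le.2 hx, fun hy' ↦ abs_le.2 ⟨?_, ?_⟩⟩
  · have := im_smoothedCGF_neg_expCurve_nonpos hε hu hy hy'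
    exact hmono.le_iff_le.1 (this.trans hx0.ge)
  · have := im_smoothedCGF_expCurve_nonneg hε hu hy hy'
    exact hmono.le_iff_le.1 (hx0.le.trans this)

lemma hasDerivAt_steepestDescent {ε : ℝ} (hε : 0 < ε) (u : ι → ℝ) {x : ℝ → ℝ}
    (hx : ∀ y, 0 < y → (smoothedCGF ε u (x y + y * I)).im = 0) {y : ℝ} (hy : 0 < y) :
    HasDerivAt x (-(smoothedCGFDeriv ε u (x y + y * I)).re /
      (smoothedCGFDeriv ε u (x y + y * I)).im) y := by
  set s : ℂ := x y + y * I with hs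
  have hsim : s.im = y := by simp [hs]
  have hs0 : 0 < s.im := hsim ▸ hy
  set d := smoothedCGFDeriv ε u s with hd
  have hdpos : 0 < d.im := im_smoothedCGFDeriv_pos hε u hs0
  -- strict differentiability of `(y, x) ↦ Im L(x + i y)`
  have hL : HasStrictDerivAt (smoothedCGF ε u) d s := by
    refine hasStrictDerivAt_of_hasDerivAt_of_continuousAt ?_
      (continuousAt_smoothedCGFDeriv ε u hs0.ne')
    filter_upwards [continuous_im.continuousAt.eventually_ne hs0.ne'] with z hz
    exact hasDerivAt_smoothedCGF ε u (Or.inl hz)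
  let e : ℝ × ℝ →L[ℝ] ℂ := ofRealCLM.comp (ContinuousLinearMap.snd ℝ ℝ ℝ) +
    (ContinuousLinearMap.mul ℝ ℂ I).comp (ofRealCLM.comp (ContinuousLinearMap.fst ℝ ℝ ℝ))
  have he (p : ℝ × ℝ) : e p = p.2 + p.1 * I := by simp [e, mul_comm]
  have hep : e (y, x y) = s := by rw [he]
  let f : ℝ × ℝ → ℝ := fun p ↦ (smoothedCGF ε u (e p)).im
  let f' : ℝ × ℝ →L[ℝ] ℝ :=
    imCLM.comp (((ContinuousLinearMap.toSpanSingleton ℂ d).restrictScalars ℝ).comp e)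
  have hf : HasStrictFDerivAt f f' (y, x y) := by
    have h1 : HasStrictFDerivAt (smoothedCGF ε u)
        ((ContinuousLinearMap.toSpanSingleton ℂ d).restrictScalars ℝ) (e (y, x y)) := by
      rw [hep]
      exact hL.hasStrictFDerivAt.restrictScalars ℝ
    exact imCLM.hasStrictFDerivAt.comp (y, x y) (h1.comp (y, x y) e.hasStrictFDerivAt)
  have hinv : (f' ∘L ContinuousLinearMap.inr ℝ ℝ ℝ).IsInvertible := by
    refine ⟨ContinuousLinearEquiv.unitsEquivAut ℝ (Units.mk0 d.im hdpos.ne'), ?_⟩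
    ext
    simp [f', he]
  have hψ1 := hf.eventually_apply_implicitFunctionOfProdDomain hinv
  have hψ2 := hf.hasStrictFDerivAt_implicitFunctionOfProdDomain hinv
  set ψ := hf.implicitFunctionOfProdDomain hinv
  have heq : x =ᶠ[𝓝 y] ψ := by
    filter_upwards [hψ1, lt_mem_nhds hy] with t ht ht0
    refine (strictMono_im_smoothedCGF hε u ht0).injective ?_
    have h1 : f (t, ψ t) = 0 := by
      rw [ht]
      simpa [f, he] using hx y hy
    simpa [f, he, hx t ht0] using h1.symm
  have hdiff : DifferentiableAt ℝ x y :=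
    (hψ2.hasFDerivAt.differentiableAt).congr_of_eventuallyEq heq
  -- differentiate the identity `Im L(x(t) + i t) = 0`
  have h1 := imCLM.hasFDerivAt.comp_hasDerivAt y
    (hasDerivAt_comp_curve hL.hasDerivAt hdiff.hasDerivAt)
  have h2 : (fun t : ℝ ↦ imCLM (smoothedCGF ε u (x t + t * I))) =ᶠ[𝓝 y] fun _ ↦ 0 := by
    filter_upwards [lt_mem_nhds hy] with t ht using hx t ht
  have h3 := h1.unique ((hasDerivAt_const y (0 : ℝ)).congr_of_eventuallyEq h2)
  have h4 : d.re + d.im * deriv x y = 0 := by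
    simpa [mul_add, add_comm] using h3
  convert! hdiff.hasDerivAt using 1
  rw [div_eq_iff hdpos.ne']
  linarith

/-- The logarithm of the moment generating function of a centred exponential along its steepest
descent curve. -/
noncomputable def expCurveLog (y : ℝ) : ℝ :=
  y * Real.cos y / Real.sin y - 1 + Real.log (Real.sin y / y)

lemma tendsto_mul_cos_div_sin :
    Tendsto (fun y ↦ y * Real.cos y / Real.sin y) (𝓝[>] 0) (𝓝 1) := by
  have h : Tendsto (fun y ↦ Real.cos y / Real.sinc y) (𝓝[>] 0) (𝓝 (Real.cos 0 / Real.sinc 0)) :=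
    ((Real.continuous_cos.continuousAt).div Real.continuous_sinc.continuousAt
      (by simp)).tendsto.mono_left nhdsWithin_le_nhds
  simp only [Real.cos_zero, Real.sinc_zero, div_one] at h
  refine h.congr' ?_
  filter_upwards [self_mem_nhdsWithin] with y hy
  rw [Real.sinc_of_ne_zero hy.out.ne', div_div_eq_mul_div, mul_comm]

lemma tendsto_expCurve : Tendsto expCurve (𝓝[>] 0) (𝓝 0) := by
  have h := tendsto_mul_cos_div_sin.const_sub 1
  rw [sub_self] at h
  exact h

lemma tendsto_expCurveLog : Tendsto expCurveLog (𝓝[>] 0) (𝓝 0) := by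
  have h : Tendsto (fun y ↦ Real.log (Real.sinc y)) (𝓝[>] 0) (𝓝 (Real.log (Real.sinc 0))) :=
    (Real.continuous_sinc.continuousAt.log (by simp)).tendsto.mono_left nhdsWithin_le_nhds
  have h' := (tendsto_mul_cos_div_sin.sub_const 1).add h
  simp only [Real.sinc_zero, Real.log_one, sub_self, add_zero] at h'
  refine h'.congr' ?_
  filter_upwards [self_mem_nhdsWithin] with y hy
  rw [Real.sinc_of_ne_zero hy.out.ne', expCurveLog]

lemma hasDerivAt_mul_cos_div_sin {y : ℝ} (hs : Real.sin y ≠ 0) :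
    HasDerivAt (fun y ↦ y * Real.cos y / Real.sin y)
      (Real.cos y / Real.sin y - y / Real.sin y ^ 2) y := by
  have h := ((hasDerivAt_id y).mul (Real.hasDerivAt_cos y)).div (Real.hasDerivAt_sin y) hs
  convert! h using 1
  simp only [id_eq, Pi.mul_apply]
  field_simp
  linear_combination y * Real.sin_sq_add_cos_sq y

lemma hasDerivAt_expCurveLog {y : ℝ} (hy : 0 < y) (hy' : y < Real.pi) :
    HasDerivAt expCurveLog (-(expCurve y ^ 2 + y ^ 2) / y) y := by
  have hs := Real.sin_pos_of_pos_of_lt_pi hy hy'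
  have h1 := (hasDerivAt_mul_cos_div_sin hs.ne').sub_const 1
  have h2 := ((Real.hasDerivAt_sin y).div (hasDerivAt_id y) hy.ne').log
    (div_pos hs hy).ne'
  convert! h1.add h2 using 1
  simp only [id_eq, Pi.div_apply, expCurve]
  field_simp
  linear_combination -y ^ 2 * Real.sin_sq_add_cos_sq y

/-- Along the steepest descent curve the logarithmic derivative is at least the one of a single
exponential. -/
lemma hasDerivAt_re_smoothedCGF_curve {ε : ℝ} (hε : 0 < ε) (u : ι → ℝ) {x : ℝ → ℝ}
    (hx : ∀ y, 0 < y → (smoothedCGF ε u (x y + y * I)).im = 0) {y : ℝ} (hy : 0 < y) :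
    HasDerivAt (fun y : ℝ ↦ (smoothedCGF ε u (x y + y * I)).re)
      (-normSq (smoothedCGFDeriv ε u (x y + y * I)) /
        (smoothedCGFDeriv ε u (x y + y * I)).im) y := by
  have hs0 : 0 < ((x y : ℂ) + y * I).im := by simpa using hy
  have h := reCLM.hasFDerivAt.comp_hasDerivAt y (hasDerivAt_comp_curve
    (hasDerivAt_smoothedCGF ε u (Or.inl hs0.ne')) (hasDerivAt_steepestDescent hε u hx hy))
  convert! h using 1
  have := (im_smoothedCGFDeriv_pos hε u hs0).ne'
  set d := smoothedCGFDeriv ε u (x y + y * I)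
  rw [reCLM_apply, mul_re, add_re, add_im, ofReal_re, ofReal_im, I_re, I_im, normSq_apply]
  field_simp
  ring

lemma tendsto_curve {x : ℝ → ℝ} (hx : ∀ y, 0 < y → y < Real.pi → |x y| ≤ expCurve y) :
    Tendsto x (𝓝[>] 0) (𝓝 0) := by
  refine squeeze_zero_norm' ?_ tendsto_expCurve
  filter_upwards [Ioo_mem_nhdsGT Real.pi_pos] with y hy using hx y hy.1 hy.2

lemma le_re_smoothedCGF_curve {ε : ℝ} (hε : 0 < ε) {u : ι → ℝ} (hu : ∑ j, u j ^ 2 = 1) {x : ℝ → ℝ}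
    (hx : ∀ y, 0 < y → (smoothedCGF ε u (x y + y * I)).im = 0)
    (hx' : ∀ y, 0 < y → y < Real.pi → |x y| ≤ expCurve y) {y : ℝ} (hy : 0 < y)
    (hy' : y < Real.pi) :
    (1 + ε) * expCurveLog y ≤ (smoothedCGF ε u (x y + y * I)).re := by
  have hderiv : ∀ t ∈ Ioo 0 Real.pi, HasDerivAt
      (fun t : ℝ ↦ (smoothedCGF ε u (x t + t * I)).re - (1 + ε) * expCurveLog t)
      (-normSq (smoothedCGFDeriv ε u (x t + t * I)) / (smoothedCGFDeriv ε u (x t + t * I)).im -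
        (1 + ε) * (-(expCurve t ^ 2 + t ^ 2) / t)) t := fun t ht ↦
    (hasDerivAt_re_smoothedCGF_curve hε u hx ht.1).sub
      ((hasDerivAt_expCurveLog ht.1 ht.2).const_mul (1 + ε))
  have hmono : MonotoneOn
      (fun t : ℝ ↦ (smoothedCGF ε u (x t + t * I)).re - (1 + ε) * expCurveLog t)
      (Ioo 0 Real.pi) := by
    refine monotoneOn_of_deriv_nonneg (convex_Ioo _ _)
      (fun t ht ↦ (hderiv t ht).continuousAt.continuousWithinAt)
      (fun t ht ↦ (hderiv t (interior_subset ht)).differentiableAt.differentiableWithinAt)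
      fun t ht ↦ ?_
    replace ht := interior_subset ht
    rw [(hderiv t ht).deriv, sub_nonneg, neg_div, neg_div, mul_neg, neg_le_neg_iff]
    have hs0 : 0 < ((x t : ℂ) + t * I).im := by simpa using ht.1
    have h1 := normSq_smoothedCGFDeriv_le hε hu hs0
    have h2 : normSq ((x t : ℂ) + t * I) ≤ expCurve t ^ 2 + t ^ 2 := by
      rw [normSq_add_mul_I, add_le_add_iff_right]
      exact sq_le_sq' (neg_le_of_abs_le (hx' t ht.1 ht.2)) (le_of_abs_le (hx' t ht.1 ht.2))
    have h3 := im_smoothedCGFDeriv_pos hε u hs0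
    rw [← mul_div_assoc, div_le_div_iff₀ h3 ht.1]
    have him : ((x t : ℂ) + t * I).im = t := by simp
    rw [him] at h1
    refine h1.trans ?_
    gcongr
  have hlim : Tendsto
      (fun t : ℝ ↦ (smoothedCGF ε u (x t + t * I)).re - (1 + ε) * expCurveLog t) (𝓝[>] 0)
      (𝓝 0) := by
    have h1 : Tendsto (fun t : ℝ ↦ (x t : ℂ) + t * I) (𝓝[>] 0) (𝓝 0) := by
      have h2 : Tendsto (fun t : ℝ ↦ (t : ℂ) * I) (𝓝[>] 0) (𝓝 (((0 : ℝ) : ℂ) * I)) :=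
        ((continuous_ofReal.mul continuous_const).tendsto 0).mono_left nhdsWithin_le_nhds
      have h3 := (continuous_ofReal.tendsto 0).comp (tendsto_curve hx')
      simpa using h3.add h2
    have h2 : Tendsto (fun s ↦ (smoothedCGF ε u s).re) (𝓝 0) (𝓝 0) := by
      have := (continuous_re.continuousAt.comp
        (hasDerivAt_smoothedCGF ε u (Or.inr rfl)).continuousAt).tendsto
      have h0 : smoothedCGF ε u 0 = 0 := by simp [smoothedCGF]
      rw [Function.comp_apply, h0, zero_re] at this
      exact this
    simpa using (h2.comp h1).sub (tendsto_expCurveLog.const_mul (1 + ε))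
  have : (0 : ℝ) ≤ (smoothedCGF ε u (x y + y * I)).re - (1 + ε) * expCurveLog y := by
    refine le_of_tendsto hlim ?_
    filter_upwards [Ioo_mem_nhdsGT hy] with t ht
    exact hmono ⟨ht.1, ht.2.trans hy'⟩ ⟨hy, hy'⟩ ht.2.le
  linarith

/-- An antiderivative of `exp ∘ expCurveLog` up to the factor `e`, with its limits at the ends of
`(0, π)`. -/
lemma exists_antideriv_exp_expCurveLog :
    ∃ K : ℝ → ℝ, (∀ y, 0 < y → y < Real.pi →
        HasDerivAt K (Real.exp 1 * Real.exp (expCurveLog y)) y) ∧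
      Tendsto K (𝓝[>] 0) (𝓝 0) ∧ Tendsto K (𝓝[<] Real.pi) (𝓝 Real.pi) := by
  -- `E` is an entire antiderivative of `(exp w - 1) / w`
  have hq : Differentiable ℂ (dslope cexp 0) := by
    rw [← differentiableOn_univ, differentiableOn_dslope univ_mem, differentiableOn_univ]
    exact differentiable_exp
  obtain ⟨E, hE⟩ := convex_univ.exists_forall_hasDerivWithinAt (hq.differentiableOn (s := univ))
  replace hE (w : ℂ) : HasDerivAt E (dslope cexp 0 w) w := by simpa using hE w (mem_univ w)
  have hdq {w : ℂ} (hw : w ≠ 0) : dslope cexp 0 w = (cexp w - 1) / w := by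
    rw [dslope_of_ne _ hw, slope_def_field]
    simp
  have hreal (p : ℝ) : (E p).im = (E 0).im := by
    have hd (t : ℝ) : HasDerivAt (fun t : ℝ ↦ (E t).im) 0 t := by
      have h := imCLM.hasFDerivAt.comp_hasDerivAt t ((hE t).comp_ofReal)
      convert! h using 1
      by_cases ht : t = 0
      · simp [ht]
      · rw [hdq (by exact_mod_cast ht), imCLM_apply, ← ofReal_exp, ← ofReal_one, ← ofReal_sub,
          ← ofReal_div, ofReal_im]
    simpa using is_const_of_deriv_eq_zero (fun t ↦ (hd t).differentiableAt)
      (fun t ↦ (hd t).deriv) p 0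
  refine ⟨fun y ↦ y + (E ((y * Real.cos y / Real.sin y : ℝ) + y * I)).im - (E 0).im,
    fun y hy hy' ↦ ?_, ?_, ?_⟩
  · have hs := Real.sin_pos_of_pos_of_lt_pi hy hy'
    have h := imCLM.hasFDerivAt.comp_hasDerivAt y
      (hasDerivAt_comp_curve (hE _) (hasDerivAt_mul_cos_div_sin hs.ne'))
    refine ((((hasDerivAt_id y).add h).sub_const (E 0).im)).congr_deriv ?_
    set p := y * Real.cos y / Real.sin y with hp
    have hw0 : (p : ℂ) + y * I ≠ 0 := fun h0 ↦ hy.ne' (by simpa using congrArg im h0)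
    have hsC : sin (y : ℂ) ≠ 0 := by exact_mod_cast hs.ne'
    have hyC : (y : ℂ) ≠ 0 := by exact_mod_cast hy.ne'
    have h1 : cexp (p + y * I) = (Real.exp p * (Real.sin y / y) : ℝ) * (p + y * I) := by
      rw [exp_add_mul_I, hp]
      push_cast
      field_simp
    have h2 : ((Real.cos y / Real.sin y - y / Real.sin y ^ 2 : ℝ) : ℂ) + I =
        (p + y * I) * (((1 - p) / y : ℝ) + I) := by
      rw [hp]
      push_cast
      field_simp
      linear_combination (-y * (sin y) ^ 2 : ℂ) * I_sq + y * sin_sq_add_cos_sq (y : ℂ)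
    have h3 : dslope cexp 0 (p + y * I) *
        ((Real.cos y / Real.sin y - y / Real.sin y ^ 2 : ℝ) + I) =
        (Real.exp p * (Real.sin y / y) : ℝ) *
          ((Real.cos y / Real.sin y - y / Real.sin y ^ 2 : ℝ) + I) -
          (((1 - p) / y : ℝ) + I) := by
      rw [hdq hw0, sub_div, sub_mul, h1, mul_div_cancel_right₀ _ hw0]
      congr 1
      rw [h2, ← mul_assoc, one_div, inv_mul_cancel₀ hw0, one_mul]
    rw [imCLM_apply, h3, sub_im, im_ofReal_mul, add_im, add_im, ofReal_im, ofReal_im, I_im,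
      expCurveLog, ← Real.exp_add]
    rw [← add_assoc, add_sub_cancel, Real.exp_add, Real.exp_log (div_pos hs hy)]
    ring
  · have h1 : Tendsto (fun y : ℝ ↦ ((y * Real.cos y / Real.sin y : ℝ) : ℂ) + y * I) (𝓝[>] 0)
        (𝓝 ((1 : ℝ) + (0 : ℝ) * I)) :=
      ((continuous_ofReal.tendsto 1).comp tendsto_mul_cos_div_sin).add
        (((continuous_ofReal.mul continuous_const).tendsto 0).mono_left nhdsWithin_le_nhds)
    have h2 := (continuous_im.tendsto _).comp ((hE _).continuousAt.tendsto.comp h1)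
    have h3 := ((tendsto_id.mono_left (nhdsWithin_le_nhds (a := (0 : ℝ)) (s := Ioi 0))).add
      h2).sub_const (E 0).im
    have h4 := hreal 1
    rw [ofReal_one] at h4
    simpa [h4] using h3
  · have hbound {p : ℝ} (hp : p < 0) (y : ℝ) :
        ‖(E (p + y * I)).im - (E 0).im‖ ≤ 2 / (-p) * |y| := by
      have h := (convex_halfSpace_re_le p).norm_image_sub_le_of_norm_hasDerivWithin_le
        (f := E) (f' := dslope cexp 0) (C := 2 / (-p)) (x := p) (y := p + y * I)
        (fun z _ ↦ (hE z).hasDerivWithinAt) (fun z hz ↦ ?_) (by simp) (by simp)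
      · rw [← hreal p, ← sub_im]
        refine (abs_im_le_norm _).trans (h.trans_eq ?_)
        simp
      · replace hz : z.re ≤ p := hz
        have hz0 : z ≠ 0 := fun h0 ↦ by simp [h0] at hz; linarith
        rw [hdq hz0, norm_div]
        have h1 : ‖cexp z - 1‖ ≤ 2 := by
          refine (norm_sub_le _ _).trans ?_
          rw [norm_exp, norm_one]
          have := Real.exp_le_one_iff.2 (hz.trans hp.le)
          linarith
        have h2 : -p ≤ ‖z‖ := (by linarith : -p ≤ -z.re).trans
          ((neg_le_abs _).trans (abs_re_le_norm z))
        have : 0 < -p := by linarith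
        gcongr
    have hlim : Tendsto (fun y ↦ y * Real.cos y / Real.sin y) (𝓝[<] Real.pi) atBot := by
      have h1 : Tendsto (fun y ↦ y * Real.cos y) (𝓝[<] Real.pi) (𝓝 (Real.pi * Real.cos Real.pi)) :=
        ((continuous_id.mul Real.continuous_cos).tendsto Real.pi).mono_left nhdsWithin_le_nhds
      have h2 : Tendsto Real.sin (𝓝[<] Real.pi) (𝓝[>] 0) := by
        refine tendsto_nhdsWithin_iff.2 ⟨?_, ?_⟩
        · simpa using (Real.continuous_sin.tendsto Real.pi).mono_left nhdsWithin_le_nhds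
        · filter_upwards [Ioo_mem_nhdsLT Real.pi_pos] with y hy
          exact Real.sin_pos_of_pos_of_lt_pi hy.1 hy.2
      exact h1.neg_mul_atTop (by simp [Real.pi_pos]) (tendsto_inv_nhdsGT_zero.comp h2)
    have hz : Tendsto (fun y : ℝ ↦
        (E ((y * Real.cos y / Real.sin y : ℝ) + y * I)).im - (E 0).im) (𝓝[<] Real.pi) (𝓝 0) := by
      refine squeeze_zero_norm' (a := fun y ↦ 2 / -(y * Real.cos y / Real.sin y) * |y|) ?_ ?_
      · filter_upwards [hlim.eventually_lt_atBot 0] with y hy using hbound hy y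
      · have h1 := (tendsto_neg_atBot_atTop.comp hlim).const_div_atTop 2
        have h2 := h1.mul ((continuous_abs.tendsto Real.pi).mono_left
          (nhdsWithin_le_nhds (s := Iio Real.pi)))
        simpa using h2
    simpa [add_sub_assoc] using
      (tendsto_id.mono_left (nhdsWithin_le_nhds (a := Real.pi) (s := Iio Real.pi))).add hz

lemma exp_smoothedCGF (ε : ℝ) (u : ι → ℝ) {s : ℂ} (hs : s.im ≠ 0 ∨ s = 0) :
    cexp (smoothedCGF ε u s) = cexp (ε * s ^ 2 / 2) * ∏ j, (cexp (-(u j * s)) / (1 - u j * s)) := by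
  rw [smoothedCGF, exp_add, exp_sum]
  congr 1
  refine Finset.prod_congr rfl fun j _ ↦ ?_
  rw [exp_sub, exp_log (slitPlane_ne_zero (one_sub_mul_mem_slitPlane (u j) hs))]

lemma div_norm_le_norm_one_sub_mul (u : ℝ) {s : ℂ} (hs : 0 < s.im) :
    s.im / ‖s‖ ≤ ‖1 - u * s‖ := by
  have hs0 : 0 < ‖s‖ := norm_pos_iff.2 fun h ↦ hs.ne' (by simp [h])
  rw [div_le_iff₀ hs0, ← norm_conj s, ← norm_mul]
  refine le_trans (le_of_eq ?_) (abs_im_le_norm _)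
  have : (1 - u * s) * (starRingEnd ℂ) s = (starRingEnd ℂ) s - ((u * normSq s : ℝ) : ℂ) := by
    rw [sub_mul, mul_assoc, mul_conj]
    push_cast
    ring
  rw [this, sub_im, ofReal_im, conj_im, sub_zero, abs_neg, abs_of_pos hs]

lemma norm_exp_smoothedCGF_le (ε : ℝ) {u : ι → ℝ} (hu : ∀ j, |u j| ≤ 1) (ξ : ℝ) {y : ℝ}
    (hy : 0 < y) :
    ‖cexp (smoothedCGF ε u (ξ + y * I))‖ ≤
      Real.exp (ε * (ξ ^ 2 - y ^ 2) / 2) *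
        (Real.exp |ξ| * ((|ξ| + y) / y)) ^ Fintype.card ι := by
  set s : ℂ := ξ + y * I with hs
  have him : s.im = y := by simp [hs]
  have hre : s.re = ξ := by simp [hs]
  rw [exp_smoothedCGF ε u (Or.inl (by rw [him]; exact hy.ne')), norm_mul, norm_prod, norm_exp]
  have h1 : ((ε : ℂ) * s ^ 2 / 2).re = ε * (ξ ^ 2 - y ^ 2) / 2 := by
    have : (ε : ℂ) * s ^ 2 / 2 = ((ε / 2 : ℝ) : ℂ) * s ^ 2 := by push_cast; ring
    rw [this, re_ofReal_mul, pow_two, mul_re, him, hre]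
    ring
  rw [h1, ← Finset.card_univ, ← Finset.prod_const]
  gcongr with j
  rw [norm_div, norm_exp, div_eq_mul_inv]
  gcongr
  · rw [neg_re, re_ofReal_mul, hre]
    refine (neg_le_abs _).trans ?_
    rw [abs_mul]
    exact mul_le_of_le_one_left (abs_nonneg _) (hu j)
  · rw [← inv_div y]
    have h2 := div_norm_le_norm_one_sub_mul (u j) (s := s) (by rw [him]; exact hy)
    have h3 : ‖s‖ ≤ |ξ| + y := by
      have := norm_le_abs_re_add_abs_im s
      rwa [him, hre, abs_of_pos hy] at this
    have h4 : 0 < ‖s‖ := norm_pos_iff.2 fun h ↦ hy.ne' (by rw [← him, h, zero_im])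
    have h5 : y / (|ξ| + y) ≤ y / ‖s‖ := by gcongr
    rw [him] at h2
    exact inv_anti₀ (by positivity) (h5.trans h2)

lemma exists_antideriv_exp_smoothedCGF (ε : ℝ) (u : ι → ℝ) :
    ∃ N : ℂ → ℂ, ∀ s : ℂ, 0 < s.im → HasDerivAt N (cexp (smoothedCGF ε u s)) s := by
  have hd : DifferentiableOn ℂ (fun s ↦ cexp (smoothedCGF ε u s)) {s | 0 < s.im} := fun s hs ↦
    (hasDerivAt_smoothedCGF ε u (Or.inl (ne_of_gt hs))).cexp.differentiableAt.differentiableWithinAt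
  obtain ⟨N, hN⟩ := (convex_halfSpace_im_gt 0).exists_forall_hasDerivWithinAt hd
  exact ⟨N, fun s hs ↦
    (hN s hs).hasDerivAt ((isOpen_lt continuous_const continuous_im).mem_nhds hs)⟩

lemma norm_antideriv_sub_le {ε : ℝ} (hε : 0 < ε) {u : ι → ℝ} (hu : ∀ j, |u j| ≤ 1) {N : ℂ → ℂ}
    (hN : ∀ s : ℂ, 0 < s.im → HasDerivAt N (cexp (smoothedCGF ε u s)) s) {x R y : ℝ} (hx : |x| ≤ R)
    (hy : 0 < y) :
    ‖N (x + y * I) - N (y * I)‖ ≤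
      Real.exp (ε * (R ^ 2 - y ^ 2) / 2) * (Real.exp R * ((R + y) / y)) ^ Fintype.card ι * R := by
  have hR : 0 ≤ R := (abs_nonneg x).trans hx
  have hderiv (t : ℝ) : HasDerivAt (fun t : ℝ ↦ N (t + y * I))
      (cexp (smoothedCGF ε u (t + y * I))) t := by
    have h : HasDerivAt (fun t : ℝ ↦ (t : ℂ) + y * I) 1 t := by
      simpa using (hasDerivAt_id t).ofReal_comp.add_const (y * I)
    have h1 := (hN (t + y * I) (by simpa using hy)).comp t h
    rw [mul_one] at h1
    exact h1
  have h := (convex_Icc (-R) R).norm_image_sub_le_of_norm_hasDerivWithin_le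
    (C := Real.exp (ε * (R ^ 2 - y ^ 2) / 2) * (Real.exp R * ((R + y) / y)) ^ Fintype.card ι)
    (fun t _ ↦ (hderiv t).hasDerivWithinAt) (fun t ht ↦ ?_)
    (show (0 : ℝ) ∈ Icc (-R) R from ⟨by linarith, hR⟩) (abs_le.1 hx)
  · simp only [ofReal_zero, zero_add, sub_zero] at h
    refine h.trans ?_
    gcongr
    simpa using hx
  · have ht' : |t| ≤ R := abs_le.2 ht
    refine (norm_exp_smoothedCGF_le ε hu t hy).trans ?_
    have : t ^ 2 ≤ R ^ 2 := sq_le_sq' ht.1 ht.2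
    gcongr

lemma expCurve_le_self {y : ℝ} (hy : 0 < y) (hy' : y ≤ 1) : expCurve y ≤ y := by
  have hs := Real.sin_pos_of_pos_of_lt_pi hy (by linarith [Real.pi_gt_three])
  have hc := Real.one_sub_sq_div_two_le_cos (x := y)
  have h1 : Real.cos y ≤ y * Real.cos y / Real.sin y := by
    rw [le_div_iff₀ hs, mul_comm]
    exact mul_le_mul_of_nonneg_right (Real.sin_le hy.le) (by nlinarith)
  rw [expCurve]
  nlinarith

lemma continuous_exp_smoothedCGF_mul_I (ε : ℝ) (u : ι → ℝ) :
    Continuous fun y : ℝ ↦ cexp (smoothedCGF ε u (y * I)) := by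
  refine continuous_iff_continuousAt.2 fun y ↦ ?_
  have h : ContinuousAt (fun s ↦ cexp (smoothedCGF ε u s)) (y * I) :=
    (hasDerivAt_smoothedCGF ε u (by
      by_cases hy : y = 0
      · simp [hy]
      · simp [hy])).cexp.continuousAt
  exact h.comp (f := fun y : ℝ ↦ (y : ℂ) * I) (by fun_prop)

/-- Deforming the imaginary axis to the steepest descent curve. -/
lemma le_integral_exp_smoothedCGF {ε : ℝ} (hε : 0 < ε) {u : ι → ℝ} (hu : ∑ j, u j ^ 2 = 1)
    (hint : IntegrableOn (fun y : ℝ ↦ (cexp (smoothedCGF ε u (y * I))).re) (Ioi 0))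
    {K : ℝ → ℝ} (hK : ∀ y, 0 < y → y < Real.pi →
        HasDerivAt K (Real.exp 1 * Real.exp (expCurveLog y)) y)
    (hK0 : Tendsto K (𝓝[>] 0) (𝓝 0)) {a : ℝ} (ha : 0 < a) (ha' : a < Real.pi) :
    Real.exp (ε * expCurveLog a) / Real.exp 1 * K a ≤
      ∫ y : ℝ in Ioi 0, (cexp (smoothedCGF ε u (y * I))).re := by
  have hu1 (j : ι) : |u j| ≤ 1 := by
    rw [← sq_le_one_iff_abs_le_one, ← hu]
    exact Finset.single_le_sum (f := fun j ↦ u j ^ 2) (fun j _ ↦ sq_nonneg _) (Finset.mem_univ j)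
  choose! x hx hxR hxc using fun y (hy : 0 < y) ↦ exists_im_smoothedCGF_eq_zero hε hu1 hy
  obtain ⟨N, hN⟩ := exists_antideriv_exp_smoothedCGF ε u
  set c := Real.exp (ε * expCurveLog a) / Real.exp 1
  have hpos {y : ℝ} (hy : 0 < y) (x : ℝ) : 0 < ((x : ℂ) + y * I).im := by simpa using hy
  let H : ℝ → ℝ := fun y ↦ (N (x y + y * I)).im
  let D : ℝ → ℝ := fun y ↦ (N (x y + y * I)).im - (N (y * I)).im
  let f : ℝ → ℝ := fun y ↦ (cexp (smoothedCGF ε u (y * I))).re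
  have hf : Continuous f := continuous_re.comp (continuous_exp_smoothedCGF_mul_I ε u)
  have hH (y : ℝ) (hy : 0 < y) :
      HasDerivAt H (Real.exp (smoothedCGF ε u (x y + y * I)).re) y := by
    have h := imCLM.hasFDerivAt.comp_hasDerivAt y
      (hasDerivAt_comp_curve (hN _ (hpos hy _)) (hasDerivAt_steepestDescent hε u hx hy))
    convert! h using 1
    have h1 : smoothedCGF ε u (x y + y * I) = ((smoothedCGF ε u (x y + y * I)).re : ℂ) :=
      Complex.ext rfl (by simpa using hx y hy)
    rw [h1, ← ofReal_exp, imCLM_apply, im_ofReal_mul]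
    simp
  have hHmono : MonotoneOn H (Ioi 0) := by
    refine monotoneOn_of_deriv_nonneg (convex_Ioi 0)
      (fun t ht ↦ (hH t ht).continuousAt.continuousWithinAt)
      (fun t ht ↦ (hH t (interior_subset ht)).differentiableAt.differentiableWithinAt) fun t ht ↦ ?_
    rw [(hH t (interior_subset ht)).deriv]
    positivity
  have hF : AntitoneOn expCurveLog (Ioo 0 Real.pi) := by
    refine antitoneOn_of_deriv_nonpos (convex_Ioo _ _)
      (fun t ht ↦ (hasDerivAt_expCurveLog ht.1 ht.2).continuousAt.continuousWithinAt)
      (fun t ht ↦ (hasDerivAt_expCurveLog (interior_subset ht).1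
        (interior_subset ht).2).differentiableAt.differentiableWithinAt) fun t ht ↦ ?_
    replace ht := interior_subset ht
    rw [(hasDerivAt_expCurveLog ht.1 ht.2).deriv, neg_div, neg_nonpos]
    have := ht.1
    positivity
  have hHK : MonotoneOn (fun y ↦ H y - c * K y) (Ioc 0 a) := by
    have hd (t : ℝ) (ht : t ∈ Ioc 0 a) := (hH t ht.1).sub
      ((hK t ht.1 (ht.2.trans_lt ha')).const_mul c)
    refine monotoneOn_of_deriv_nonneg (convex_Ioc 0 a)
      (fun t ht ↦ (hd t ht).continuousAt.continuousWithinAt)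
      (fun t ht ↦ (hd t (interior_subset ht)).differentiableAt.differentiableWithinAt) fun t ht ↦ ?_
    replace ht := interior_subset ht
    have htπ := ht.2.trans_lt ha'
    refine (hd t ht).deriv.symm ▸ sub_nonneg.2 ?_
    rw [← mul_assoc, div_mul_cancel₀ _ (Real.exp_pos 1).ne', ← Real.exp_add, Real.exp_le_exp]
    have h1 := le_re_smoothedCGF_curve hε hu hx hxc ht.1 htπ
    have h2 := hF ⟨ht.1, htπ⟩ ⟨ha, ha'⟩ ht.2
    nlinarith
  have hprim {y Y : ℝ} (hy : 0 < y) (hY : y ≤ Y) :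
      ∫ t in y..Y, f t = (N (Y * I)).im - (N (y * I)).im := by
    refine intervalIntegral.integral_eq_sub_of_hasDerivAt
      (f := fun t : ℝ ↦ (N (t * I)).im) (fun t ht ↦ ?_) (hf.intervalIntegrable _ _)
    rw [uIcc_of_le hY] at ht
    have h := imCLM.hasFDerivAt.comp_hasDerivAt t (hasDerivAt_comp_curve (x := fun _ ↦ 0)
      (hN _ (hpos (hy.trans_le ht.1) _)) (hasDerivAt_const t 0))
    simpa [f, Function.comp_def] using h
  have hD {y R : ℝ} (hy : 0 < y) (hR : |x y| ≤ R) : ‖D y‖ ≤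
      Real.exp (ε * (R ^ 2 - y ^ 2) / 2) * (Real.exp R * ((R + y) / y)) ^ Fintype.card ι * R := by
    refine le_trans ?_ (norm_antideriv_sub_le hε hu1 hN hR hy)
    simp only [D]
    rw [← sub_im]
    exact abs_im_le_norm _
  have hD0 : Tendsto D (𝓝[>] 0) (𝓝 0) := by
    refine squeeze_zero_norm' (a := fun y ↦ (Real.exp y * 2) ^ Fintype.card ι * y) ?_ ?_
    · filter_upwards [Ioo_mem_nhdsGT one_pos] with y hy
      have h := hD hy.1 ((hxc y hy.1 (by linarith [Real.pi_gt_three, hy.2])).trans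
        (expCurve_le_self hy.1 hy.2.le))
      rwa [sub_self, mul_zero, zero_div, Real.exp_zero, one_mul, ← two_mul,
        mul_div_cancel_right₀ _ hy.1.ne'] at h
    · have : Continuous fun y : ℝ ↦ (Real.exp y * 2) ^ Fintype.card ι * y := by fun_prop
      simpa using (this.tendsto 0).mono_left (nhdsWithin_le_nhds (s := Ioi 0))
  have hDtop : Tendsto D atTop (𝓝 0) := by
    set R : ℝ := Fintype.card ι * (1 + Real.pi) / ε
    have hR0 : 0 ≤ R := by have := Real.pi_pos; positivity
    refine squeeze_zero_norm'
      (a := fun y ↦ Real.exp (ε * (R ^ 2 - y ^ 2) / 2) *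
        (Real.exp R * (R + 1)) ^ Fintype.card ι * R) ?_ ?_
    · filter_upwards [eventually_ge_atTop 1] with y hy
      have hy0 : 0 < y := one_pos.trans_le hy
      have hyR : |x y| ≤ R := by
        refine (hxR y hy0).trans ?_
        rw [div_le_div_iff₀ (by positivity) hε]
        have : y + Real.pi ≤ (1 + Real.pi) * y := by nlinarith [Real.pi_pos]
        have h2 : 0 ≤ (Fintype.card ι : ℝ) * ε := by positivity
        nlinarith [mul_le_mul_of_nonneg_left this h2]
      refine (hD hy0 hyR).trans ?_
      have : (R + y) / y ≤ R + 1 := by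
        rw [div_le_iff₀ hy0]
        nlinarith
      gcongr
    · have h1 : Tendsto (fun y : ℝ ↦ ε * (R ^ 2 - y ^ 2) / 2) atTop atBot := by
        have h2 : Tendsto (fun y : ℝ ↦ R ^ 2 - y ^ 2) atTop atBot :=
          tendsto_const_nhds.add_atBot
            (tendsto_neg_atTop_atBot.comp (tendsto_pow_atTop two_ne_zero))
        exact (h2.const_mul_atBot hε).atBot_div_const two_pos
      simpa using ((Real.tendsto_exp_atBot.comp h1).mul_const
        ((Real.exp R * (R + 1)) ^ Fintype.card ι)).mul_const R
  have hstep {y Y : ℝ} (hy : 0 < y) (hya : y ≤ a) (hY : a ≤ Y) :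
      c * K a - c * K y - D Y + D y ≤ (∫ t in 0..Y, f t) - ∫ t in 0..y, f t := by
    rw [intervalIntegral.integral_interval_sub_left (hf.intervalIntegrable _ _)
      (hf.intervalIntegrable _ _), hprim hy (hya.trans hY)]
    have h1 : H y - c * K y ≤ H a - c * K a := hHK ⟨hy, hya⟩ ⟨ha, le_rfl⟩ hya
    have h2 : H a ≤ H Y := hHmono ha (ha.trans_le hY) hY
    simp only [D, H] at *
    linarith
  have hstep' {Y : ℝ} (hY : a ≤ Y) : c * K a - D Y ≤ ∫ t in 0..Y, f t := by
    have h1 : Tendsto (fun y ↦ c * K a - c * K y - D Y + D y) (𝓝[>] 0)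
        (𝓝 (c * K a - c * 0 - D Y + 0)) :=
      (((hK0.const_mul c).const_sub _).sub_const _).add hD0
    have h2 : Tendsto (fun y ↦ (∫ t in 0..Y, f t) - ∫ t in 0..y, f t) (𝓝[>] 0)
        (𝓝 ((∫ t in 0..Y, f t) - ∫ t in 0..0, f t)) :=
      (((intervalIntegral.continuous_primitive (fun _ _ ↦ hf.intervalIntegrable _ _) 0).tendsto
        0).mono_left nhdsWithin_le_nhds).const_sub _
    have h3 := le_of_tendsto_of_tendsto h1 h2 (by
      filter_upwards [Ioc_mem_nhdsGT ha] with y hy using hstep hy.1 hy.2 hY)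
    simpa using h3
  have h1 := intervalIntegral_tendsto_integral_Ioi 0 hint tendsto_id
  have h2 := hDtop.const_sub (c * K a)
  rw [sub_zero] at h2
  exact le_of_tendsto_of_tendsto h2 h1 (by
    filter_upwards [eventually_ge_atTop a] with Y hY using hstep' hY)

end Contour

lemma exponentialPDFReal_one (x : ℝ) :
    exponentialPDFReal 1 x = if 0 ≤ x then Real.exp (-x) else 0 := by
  simp [exponentialPDFReal, gammaPDFReal]

lemma expMeasure_one_eq_withDensity :
    expMeasure 1 = volume.withDensity fun x ↦ ENNReal.ofReal (exponentialPDFReal 1 x) := rfl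

instance isProbabilityMeasure_expMeasure_one : IsProbabilityMeasure (expMeasure 1) :=
  isProbabilityMeasure_expMeasure one_pos

lemma exponentialPDFReal_one_nonneg (x : ℝ) : 0 ≤ exponentialPDFReal 1 x :=
  exponentialPDFReal_nonneg one_pos x

lemma exponentialPDFReal_one_le_one (x : ℝ) : exponentialPDFReal 1 x ≤ 1 := by
  rw [exponentialPDFReal_one]
  split_ifs with h
  · simpa using h
  · exact zero_le_one

lemma continuousAt_exponentialPDFReal_one {x : ℝ} (hx : x ≠ 0) :
    ContinuousAt (exponentialPDFReal 1) x := by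
  rcases hx.lt_or_gt with h | h
  · refine (continuousAt_const (y := (0 : ℝ))).congr ?_
    filter_upwards [gt_mem_nhds h] with t ht
    rw [exponentialPDFReal_one, if_neg (not_le.2 ht)]
  · refine (Real.continuous_exp.comp continuous_neg).continuousAt.congr ?_
    filter_upwards [lt_mem_nhds h] with t ht
    rw [exponentialPDFReal_one, if_pos ht.le, Function.comp_apply]

lemma integral_exp_mul_expMeasure_one (t : ℝ) :
    ∫ x : ℝ, Complex.exp (t * (x - 1) * Complex.I) ∂(expMeasure 1) =
      Complex.exp (-(t * Complex.I)) / (1 - t * Complex.I) := by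
  rw [expMeasure_one_eq_withDensity, integral_withDensity_eq_integral_toReal_smul
    ((measurable_exponentialPDFReal 1).ennreal_ofReal) (ae_of_all _ fun _ ↦ ENNReal.ofReal_lt_top)]
  have h1 (x : ℝ) : (ENNReal.ofReal (exponentialPDFReal 1 x)).toReal •
      Complex.exp (t * (x - 1) * Complex.I) = (Set.Ici 0).indicator (fun x : ℝ ↦
        Complex.exp (-(t * Complex.I)) * Complex.exp ((t * Complex.I - 1) * x)) x := by
    rw [ENNReal.toReal_ofReal (exponentialPDFReal_one_nonneg x), exponentialPDFReal_one]
    by_cases hx : 0 ≤ x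
    · rw [if_pos hx, Set.indicator_of_mem (Set.mem_Ici.2 hx), Complex.real_smul, Complex.ofReal_exp,
        ← Complex.exp_add, ← Complex.exp_add]
      congr 1
      push_cast
      ring
    · rw [if_neg hx, Set.indicator_of_notMem (by simpa using hx), zero_smul]
  simp_rw [h1]
  rw [integral_indicator measurableSet_Ici, integral_const_mul, integral_Ici_eq_integral_Ioi,
    integral_exp_mul_complex_Ioi (by simp)]
  rw [Complex.ofReal_zero, mul_zero, Complex.exp_zero, neg_div, ← div_neg, neg_sub, mul_one_div]

section Law

variable {ι : Type*} [Fintype ι]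

/-- The law of `∑ j, u j * (Z j - 1)` for independent standard exponential `Z j`. -/
noncomputable def expLaw (u : ι → ℝ) : Measure ℝ :=
  (Measure.pi fun _ : ι ↦ expMeasure 1).map fun z ↦ ∑ j, u j * (z j - 1)

lemma measurable_expSum (u : ι → ℝ) : Measurable fun z : ι → ℝ ↦ ∑ j, u j * (z j - 1) := by
  fun_prop

instance isProbabilityMeasure_expLaw (u : ι → ℝ) : IsProbabilityMeasure (expLaw u) :=
  Measure.isProbabilityMeasure_map (measurable_expSum u).aemeasurable

lemma charFun_expLaw (u : ι → ℝ) (t : ℝ) :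
    charFun (expLaw u) t =
      ∏ j, (Complex.exp (-(u j * (t * Complex.I))) / (1 - u j * (t * Complex.I))) := by
  rw [charFun_apply_real, expLaw, integral_map (measurable_expSum u).aemeasurable (by fun_prop)]
  have h (z : ι → ℝ) : Complex.exp (t * ((∑ j, u j * (z j - 1) : ℝ) : ℂ) * Complex.I) =
      ∏ j, Complex.exp ((u j * t : ℝ) * (z j - 1) * Complex.I) := by
    rw [← Complex.exp_sum]
    push_cast
    rw [Finset.mul_sum, Finset.sum_mul]
    congr 1
    refine Finset.sum_congr rfl fun j _ ↦ ?_
    ring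
  simp_rw [h]
  rw [integral_fintype_prod_eq_prod
    (f := fun (j : ι) (x : ℝ) ↦ Complex.exp ((u j * t : ℝ) * (x - 1) * Complex.I))]
  refine Finset.prod_congr rfl fun j _ ↦ ?_
  rw [integral_exp_mul_expMeasure_one]
  push_cast
  ring_nf

lemma exp_smoothedCGF_mul_I (ε : ℝ) (u : ι → ℝ) (t : ℝ) :
    Complex.exp (smoothedCGF ε u (t * Complex.I)) =
      Real.exp (-(ε * t ^ 2 / 2)) * charFun (expLaw u) t := by
  rw [charFun_expLaw, exp_smoothedCGF]
  · congr 1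
    rw [mul_pow, Complex.I_sq]
    push_cast
    ring_nf
  · by_cases ht : t = 0 <;> simp [ht]

lemma integrable_exp_smoothedCGF_mul_I {ε : ℝ} (hε : 0 < ε) (u : ι → ℝ) :
    Integrable fun t : ℝ ↦ Complex.exp (smoothedCGF ε u (t * Complex.I)) := by
  refine (integrable_exp_neg_mul_sq (half_pos hε)).mono'
    (continuous_exp_smoothedCGF_mul_I ε u).aestronglyMeasurable (ae_of_all _ fun t ↦ ?_)
  rw [exp_smoothedCGF_mul_I, norm_mul, Complex.norm_real, Real.norm_of_nonneg (Real.exp_pos _).le]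
  refine (mul_le_of_le_one_right (Real.exp_pos _).le (norm_charFun_le_one _)).trans_eq ?_
  ring_nf

lemma integral_exp_neg_sq_expLaw {ε : ℝ} (hε : 0 < ε) (u : ι → ℝ) :
    ∫ x, Real.exp (-(x ^ 2 / (2 * ε))) ∂(expLaw u) =
      √(2 * Real.pi * ε) / Real.pi *
        ∫ t : ℝ in Set.Ioi 0, (Complex.exp (smoothedCGF ε u (t * Complex.I))).re := by
  set v : NNReal := ⟨1 / ε, by positivity⟩ with hv
  have hv' : (v : ℝ) = 1 / ε := rfl
  have hv0 : v ≠ 0 := by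
    rw [Ne, ← NNReal.coe_eq_zero, hv']
    positivity
  have h1 (x : ℝ) : ((Real.exp (-(x ^ 2 / (2 * ε))) : ℝ) : ℂ) = charFun (gaussianReal 0 v) x := by
    rw [charFun_gaussianReal, hv']
    push_cast
    congr 1
    field_simp
    ring
  have h2 : ∫ x, charFun (gaussianReal 0 v) x ∂(expLaw u) =
      ∫ t, charFun (expLaw u) t ∂(gaussianReal 0 v) := by
    simp_rw [charFun_apply_real]
    rw [integral_integral_swap]
    · refine integral_congr_ae (ae_of_all _ fun t ↦ integral_congr_ae (ae_of_all _ fun x ↦ ?_))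
      simp only [mul_comm (x : ℂ)]
    · refine (integrable_const (1 : ℝ)).mono' (by fun_prop) (ae_of_all _ fun p ↦ ?_)
      simp [Function.uncurry, Complex.norm_exp]
  have h3 : ∫ t, charFun (expLaw u) t ∂(gaussianReal 0 v) =
      ∫ t : ℝ, ((√(ε / (2 * Real.pi)) : ℝ) : ℂ) *
        Complex.exp (smoothedCGF ε u (t * Complex.I)) := by
    rw [integral_gaussianReal_eq_integral_smul hv0]
    refine integral_congr_ae (ae_of_all _ fun t ↦ ?_)
    simp only [exp_smoothedCGF_mul_I, gaussianPDFReal, hv', Complex.real_smul, Complex.ofReal_mul,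
      ← mul_assoc]
    congr 3
    · rw [← Real.sqrt_inv]
      congr 1
      field_simp
    · congr 1
      field_simp
      ring
  have h4 : (∫ x, Real.exp (-(x ^ 2 / (2 * ε))) ∂(expLaw u)) = √(ε / (2 * Real.pi)) *
      ∫ t : ℝ, (Complex.exp (smoothedCGF ε u (t * Complex.I))).re := by
    have h5 := congrArg Complex.re (((integral_congr_ae (ae_of_all _ h1)).trans h2).trans h3)
    rw [integral_complex_ofReal, Complex.ofReal_re, integral_const_mul, Complex.re_ofReal_mul] at h5
    rw [h5]
    congr 1
    exact (Complex.reCLM.integral_comp_comm (integrable_exp_smoothedCGF_mul_I hε u)).symm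
  have h6 (t : ℝ) : (Complex.exp (smoothedCGF ε u ((|t| : ℝ) * Complex.I))).re =
      (Complex.exp (smoothedCGF ε u (t * Complex.I))).re := by
    rcases abs_choice t with h | h
    · rw [h]
    · rw [h, exp_smoothedCGF_mul_I, exp_smoothedCGF_mul_I, charFun_neg, neg_sq,
        Complex.re_ofReal_mul, Complex.re_ofReal_mul, Complex.conj_re]
  have h7 : √(ε / (2 * Real.pi)) * 2 = √(2 * Real.pi * ε) / Real.pi := by
    have h8 : 2 * Real.pi * ε = (2 * Real.pi) ^ 2 * (ε / (2 * Real.pi)) := by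
      field_simp
    rw [h8, Real.sqrt_mul (sq_nonneg _), Real.sqrt_sq Real.two_pi_pos.le]
    field_simp
  rw [h4, ← h7, mul_assoc, ← integral_comp_abs
    (f := fun t : ℝ ↦ (Complex.exp (smoothedCGF ε u (t * Complex.I))).re)]
  simp_rw [h6]

end Law

section Density

open Filter Topology Set

variable {n : ℕ}

/-- The density of `v * (Z - 1)` for a standard exponential `Z`. -/
noncomputable def scaledExpPDF (v x : ℝ) : ℝ := |v⁻¹| * exponentialPDFReal 1 (x / v + 1)

lemma measurable_scaledExpPDF (v : ℝ) : Measurable (scaledExpPDF v) :=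
  ((measurable_exponentialPDFReal 1).comp (by fun_prop)).const_mul _

lemma scaledExpPDF_nonneg (v x : ℝ) : 0 ≤ scaledExpPDF v x :=
  mul_nonneg (abs_nonneg _) (exponentialPDFReal_one_nonneg _)

lemma scaledExpPDF_le (v x : ℝ) : scaledExpPDF v x ≤ |v⁻¹| :=
  mul_le_of_le_one_right (abs_nonneg _) (exponentialPDFReal_one_le_one _)

lemma continuousAt_scaledExpPDF {v x : ℝ} (hv : v ≠ 0) (hx : x ≠ -v) :
    ContinuousAt (scaledExpPDF v) x := by
  have h : x / v + 1 ≠ 0 := fun h ↦ hx (by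
    rw [← eq_neg_iff_add_eq_zero, div_eq_iff hv] at h
    linarith)
  exact continuousAt_const.mul
    ((continuousAt_exponentialPDFReal_one h).comp (f := fun x ↦ x / v + 1) (by fun_prop))

lemma integrable_scaledExpPDF (v x : ℝ) (ρ : Measure ℝ) [IsFiniteMeasure ρ] :
    Integrable (fun t ↦ scaledExpPDF v (x - t)) ρ :=
  (integrable_const |v⁻¹|).mono'
    ((measurable_scaledExpPDF v).comp (by fun_prop)).aestronglyMeasurable (ae_of_all _ fun t ↦ by
      rw [Real.norm_of_nonneg (scaledExpPDF_nonneg _ _)]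
      exact scaledExpPDF_le _ _)

lemma lintegral_comp_mul_add {v : ℝ} (hv : v ≠ 0) (d : ℝ) {Q : ℝ → ENNReal} (hQ : Measurable Q) :
    ∫⁻ a, Q (v * a + d) = ENNReal.ofReal |v⁻¹| * ∫⁻ x, Q x := by
  rw [← lintegral_map (f := fun x ↦ Q (x + d)) (g := fun a ↦ v * a) (by fun_prop) (by fun_prop),
    Real.map_volume_mul_left hv, lintegral_smul_measure, lintegral_add_right_eq_self Q d,
    smul_eq_mul]

lemma lintegral_expMeasure_comp_affine {v : ℝ} (hv : v ≠ 0) (t : ℝ) {F : ℝ → ENNReal}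
    (hF : Measurable F) :
    ∫⁻ a, F (v * (a - 1) + t) ∂(expMeasure 1) =
      ∫⁻ x, F x * ENNReal.ofReal (scaledExpPDF v (x - t)) := by
  have hp : Measurable fun x ↦ ENNReal.ofReal (exponentialPDFReal 1 x) :=
    (measurable_exponentialPDFReal 1).ennreal_ofReal
  rw [expMeasure_one_eq_withDensity, lintegral_withDensity_eq_lintegral_mul _ hp (by fun_prop)]
  have h (a : ℝ) : (fun x ↦ F x * ENNReal.ofReal (exponentialPDFReal 1 ((x - t) / v + 1)))
      (v * a + (t - v)) = ((fun x ↦ ENNReal.ofReal (exponentialPDFReal 1 x)) *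
        fun a ↦ F (v * (a - 1) + t)) a := by
    have h1 : v * a + (t - v) = v * (a - 1) + t := by ring
    have h2 : (v * (a - 1) + t - t) / v + 1 = a := by field_simp; ring
    rw [Pi.mul_apply, mul_comm (ENNReal.ofReal _)]
    simp only [h1, h2]
  have hp' : Measurable fun x ↦ ENNReal.ofReal (exponentialPDFReal 1 ((x - t) / v + 1)) :=
    hp.comp (by fun_prop)
  refine (lintegral_congr fun a ↦ (h a).symm).trans
    ((lintegral_comp_mul_add hv (t - v) (hF.mul hp')).trans ?_)
  rw [← lintegral_const_mul _ (hF.mul hp')]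
  refine lintegral_congr fun x ↦ ?_
  rw [scaledExpPDF, ENNReal.ofReal_mul (abs_nonneg _), Pi.mul_apply, mul_left_comm]

/-- A density of `expLaw u`, obtained by conditioning on all coordinates but the `k`-th. -/
noncomputable def expLawDensity (u : Fin (n + 1) → ℝ) (k : Fin (n + 1)) (x : ℝ) : ℝ :=
  ∫ t, scaledExpPDF (u k) (x - t) ∂(expLaw fun i ↦ u (k.succAbove i))

lemma ofReal_expLawDensity (u : Fin (n + 1) → ℝ) (k : Fin (n + 1)) (x : ℝ) :
    ENNReal.ofReal (expLawDensity u k x) =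
      ∫⁻ t, ENNReal.ofReal (scaledExpPDF (u k) (x - t)) ∂(expLaw fun i ↦ u (k.succAbove i)) :=
  ofReal_integral_eq_lintegral_ofReal (integrable_scaledExpPDF _ _ _)
    (ae_of_all _ fun _ ↦ scaledExpPDF_nonneg _ _)

lemma expLaw_eq_withDensity (u : Fin (n + 1) → ℝ) {k : Fin (n + 1)} (hk : u k ≠ 0) :
    expLaw u = volume.withDensity fun x ↦ ENNReal.ofReal (expLawDensity u k x) := by
  ext A hA
  set F : ℝ → ENNReal := A.indicator 1 with hF_def
  have hF : Measurable F := measurable_one.indicator hA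
  have hmeas : Measurable fun p : ℝ × ℝ ↦ ENNReal.ofReal (scaledExpPDF (u k) (p.1 - p.2)) :=
    ((measurable_scaledExpPDF _).comp (by fun_prop)).ennreal_ofReal
  have hpres := measurePreserving_piFinSuccAbove (fun _ : Fin (n + 1) ↦ expMeasure 1) k
  set S : (Fin n → ℝ) → ℝ := fun w ↦ ∑ i, u (k.succAbove i) * (w i - 1) with hS
  have hSm : Measurable S := measurable_expSum _
  calc expLaw u A = ∫⁻ x, F x ∂(expLaw u) := by rw [hF_def, lintegral_indicator_one hA]
    _ = ∫⁻ z, F (∑ j, u j * (z j - 1)) ∂(Measure.pi fun _ ↦ expMeasure 1) :=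
      lintegral_map hF (measurable_expSum u)
    _ = ∫⁻ p, F (u k * (p.1 - 1) + S p.2)
          ∂((expMeasure 1).prod (Measure.pi fun _ : Fin n ↦ expMeasure 1)) := by
      rw [← hpres.lintegral_comp (by fun_prop)]
      refine lintegral_congr fun z ↦ ?_
      rw [Fin.sum_univ_succAbove _ k]
      rfl
    _ = ∫⁻ w, ∫⁻ a, F (u k * (a - 1) + S w) ∂(expMeasure 1)
          ∂(Measure.pi fun _ : Fin n ↦ expMeasure 1) :=
      lintegral_prod_symm' _ (by fun_prop)
    _ = ∫⁻ w, (∫⁻ x, F x * ENNReal.ofReal (scaledExpPDF (u k) (x - S w)))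
          ∂(Measure.pi fun _ : Fin n ↦ expMeasure 1) :=
      lintegral_congr fun w ↦ lintegral_expMeasure_comp_affine hk _ hF
    _ = ∫⁻ t, (∫⁻ x, F x * ENNReal.ofReal (scaledExpPDF (u k) (x - t)))
          ∂(expLaw fun i ↦ u (k.succAbove i)) := by
      refine (lintegral_map
        (f := fun t ↦ ∫⁻ x : ℝ, F x * ENNReal.ofReal (scaledExpPDF (u k) (x - t)))
        ?_ hSm).symm
      exact Measurable.lintegral_prod_left' ((hF.comp measurable_fst).mul hmeas)
    _ = ∫⁻ x, F x * ENNReal.ofReal (expLawDensity u k x) := by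
      rw [lintegral_lintegral_swap]
      · refine lintegral_congr fun x ↦ ?_
        have hx : Measurable fun t ↦ ENNReal.ofReal (scaledExpPDF (u k) (x - t)) :=
          ((measurable_scaledExpPDF _).comp (by fun_prop)).ennreal_ofReal
        exact (lintegral_const_mul _ hx).trans (by rw [ofReal_expLawDensity])
      · exact ((hF.comp measurable_snd).mul (hmeas.comp measurable_swap)).aemeasurable
    _ = _ := by
      rw [withDensity_apply _ hA, ← lintegral_indicator hA]
      refine lintegral_congr fun x ↦ ?_
      by_cases hx : x ∈ A <;> simp [hF_def, hx]

lemma expLaw_singleton (u : Fin (n + 1) → ℝ) {k : Fin (n + 1)} (hk : u k ≠ 0) (c : ℝ) :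
    expLaw u {c} = 0 := by
  rw [expLaw_eq_withDensity u hk]
  exact withDensity_absolutelyContinuous _ _ (by simp)

lemma expLaw_zero {ι : Type*} [Fintype ι] : expLaw (0 : ι → ℝ) = Measure.dirac 0 := by
  simp [expLaw]

lemma continuousAt_expLawDensity (hn : 1 ≤ n) (u : Fin (n + 1) → ℝ) {k : Fin (n + 1)}
    (hk : u k ≠ 0) : ContinuousAt (expLawDensity u k) 0 := by
  have hatom : expLaw (fun i ↦ u (k.succAbove i)) {u k} = 0 := by
    obtain ⟨m, rfl⟩ := Nat.exists_eq_add_of_le' hn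
    by_cases h : (fun i ↦ u (k.succAbove i)) = 0
    · rw [h, expLaw_zero]
      simp [hk.symm]
    · obtain ⟨i, hi⟩ := Function.ne_iff.1 h
      exact expLaw_singleton (fun i ↦ u (k.succAbove i)) (k := i) hi _
  refine continuousAt_of_dominated (bound := fun _ ↦ |(u k)⁻¹|)
    (Eventually.of_forall fun x ↦ (integrable_scaledExpPDF _ _ _).aestronglyMeasurable)
    (Eventually.of_forall fun x ↦ ae_of_all _ fun t ↦ ?_) (integrable_const _) ?_
  · rw [Real.norm_of_nonneg (scaledExpPDF_nonneg _ _)]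
    exact scaledExpPDF_le _ _
  · filter_upwards [measure_eq_zero_iff_ae_notMem.1 hatom] with t ht
    refine (continuousAt_scaledExpPDF hk ?_).comp (f := fun x ↦ x - t) (by fun_prop)
    rw [zero_sub, Ne, neg_inj]
    exact ht

lemma withDensity_apply_le {f : ℝ → ℝ} {M : ℝ} {s : Set ℝ} (hs : MeasurableSet s)
    (hf : ∀ x ∈ s, f x ≤ M) :
    volume.withDensity (fun x ↦ ENNReal.ofReal (f x)) s ≤ ENNReal.ofReal M * volume s := by
  rw [withDensity_apply _ hs, ← setLIntegral_const]
  exact setLIntegral_mono' hs fun x hx ↦ ENNReal.ofReal_le_ofReal (hf x hx)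

/-- Densities of the same measure that are continuous at a point agree there. -/
lemma le_of_withDensity_eq {f g : ℝ → ℝ} {a : ℝ}
    (hfg : volume.withDensity (fun x ↦ ENNReal.ofReal (f x)) =
      volume.withDensity (fun x ↦ ENNReal.ofReal (g x)))
    (hf : ContinuousAt f a) (hg : ContinuousAt g a) (hpos : 0 < g a) : g a ≤ f a := by
  by_contra! hlt
  obtain ⟨p, hp, hp'⟩ := exists_between (max_lt hlt hpos)
  obtain ⟨q, hq, hq'⟩ := exists_between hp'
  obtain ⟨r, hr, h⟩ := Metric.eventually_nhds_iff_ball.1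
    ((hf.eventually (gt_mem_nhds ((le_max_left _ _).trans_lt hp))).and
      (hg.eventually (lt_mem_nhds hq')))
  have h1 : ENNReal.ofReal q * volume (Metric.ball a r) ≤
      ENNReal.ofReal p * volume (Metric.ball a r) := by
    refine le_trans ?_ (withDensity_apply_le measurableSet_ball fun x hx ↦ (h x hx).1.le)
    rw [hfg, withDensity_apply _ measurableSet_ball, ← setLIntegral_const]
    exact setLIntegral_mono' measurableSet_ball fun x hx ↦
      ENNReal.ofReal_le_ofReal (h x hx).2.le
  have h2 := (ENNReal.mul_le_mul_iff_left (Metric.measure_ball_pos volume a hr).ne'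
    measure_ball_lt_top.ne).1 h1
  have hp0 : 0 ≤ p := (le_max_right _ _).trans hp.le
  exact hq.not_ge ((ENNReal.ofReal_le_ofReal_iff hp0).1 h2)

lemma integral_exp_neg_sq_le {f : ℝ → ℝ} {ν : Measure ℝ} [IsProbabilityMeasure ν]
    (hν : ν = volume.withDensity fun x ↦ ENNReal.ofReal (f x)) {M r : ℝ} (hM : 0 ≤ M) (hr : 0 < r)
    (hf : ∀ x ∈ Metric.ball 0 r, f x ≤ M) {ε : ℝ} (hε : 0 < ε) :
    ∫ x, Real.exp (-(x ^ 2 / (2 * ε))) ∂ν ≤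
      M * √(2 * Real.pi * ε) + Real.exp (-(r ^ 2 / (2 * ε))) := by
  have hle : ν.restrict (Metric.ball 0 r) ≤ ENNReal.ofReal M • volume := by
    refine Measure.le_iff.2 fun s hs ↦ ?_
    rw [Measure.restrict_apply hs, hν, Measure.smul_apply, smul_eq_mul]
    refine (withDensity_apply_le (hs.inter measurableSet_ball) fun x hx ↦ hf x hx.2).trans ?_
    gcongr
    exact inter_subset_left
  have hgauss : Integrable fun x : ℝ ↦ Real.exp (-(x ^ 2 / (2 * ε))) := by
    convert! integrable_exp_neg_mul_sq (b := 1 / (2 * ε)) (by positivity) using 3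
    ring
  have hval : ∫ x : ℝ, Real.exp (-(x ^ 2 / (2 * ε))) = √(2 * Real.pi * ε) := by
    convert! integral_gaussian (1 / (2 * ε)) using 1
    · congr with x
      ring_nf
    · rw [div_div_eq_mul_div, div_one]
      ring_nf
  have hint : Integrable (fun x : ℝ ↦ Real.exp (-(x ^ 2 / (2 * ε)))) ν := by
    refine (integrable_const (1 : ℝ)).mono' (by fun_prop) (ae_of_all _ fun x ↦ ?_)
    rw [Real.norm_of_nonneg (Real.exp_pos _).le, Real.exp_le_one_iff, neg_nonpos]
    positivity
  rw [← integral_add_compl (s := Metric.ball 0 r) measurableSet_ball hint]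
  refine add_le_add ?_ ?_
  · refine (integral_mono_measure hle (ae_of_all _ fun x ↦ (Real.exp_pos _).le)
      (hgauss.smul_measure ENNReal.ofReal_ne_top)).trans_eq ?_
    rw [integral_smul_measure, ENNReal.toReal_ofReal hM, hval, smul_eq_mul]
  · have h1 : ∫ x in (Metric.ball 0 r)ᶜ, Real.exp (-(x ^ 2 / (2 * ε))) ∂ν ≤
        ∫ _ in (Metric.ball 0 r)ᶜ, Real.exp (-(r ^ 2 / (2 * ε))) ∂ν := by
      refine setIntegral_mono_on hint.integrableOn (integrable_const _).integrableOn
        measurableSet_ball.compl fun x hx ↦ ?_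
      have : r ≤ |x| := by simpa using hx
      have h2 : r ^ 2 ≤ x ^ 2 := by
        rw [← sq_abs x]
        gcongr
      gcongr
    refine h1.trans ?_
    rw [setIntegral_const, smul_eq_mul]
    exact mul_le_of_le_one_left (Real.exp_pos _).le measureReal_le_one

/-- The density at the origin of `∑ j, u j * (Z j - 1)` is at least `1 / e`. -/
lemma inv_exp_one_le_of_expLaw_eq_withDensity {ι : Type*} [Fintype ι] {u : ι → ℝ}
    (hu : ∑ j, u j ^ 2 = 1) {f : ℝ → ℝ}
    (hf : expLaw u = volume.withDensity fun x ↦ ENNReal.ofReal (f x)) {M r : ℝ} (hM : 0 ≤ M)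
    (hr : 0 < r) (hfM : ∀ x ∈ Metric.ball 0 r, f x ≤ M) : 1 / Real.exp 1 ≤ M := by
  obtain ⟨K, hK, hK0, hKπ⟩ := exists_antideriv_exp_expCurveLog
  have hε (a : ℝ) (ha : 0 < a) (ha' : a < Real.pi) (ε : ℝ) (hε : 0 < ε) :
      Real.exp (ε * expCurveLog a) / Real.exp 1 * K a / Real.pi ≤
        M + √(2 * Real.pi * ε) / (Real.pi * r ^ 2) := by
    have h1 := le_integral_exp_smoothedCGF hε hu
      (integrable_exp_smoothedCGF_mul_I hε u).re.integrableOn hK hK0 ha ha'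
    have h2 := integral_exp_neg_sq_expLaw hε u
    have h3 := integral_exp_neg_sq_le hf hM hr hfM hε
    have hsq : 0 < √(2 * Real.pi * ε) := by have := Real.pi_pos; positivity
    have h4 : Real.exp (-(r ^ 2 / (2 * ε))) ≤
        √(2 * Real.pi * ε) * (√(2 * Real.pi * ε) / (Real.pi * r ^ 2)) := by
      have h5 := Real.add_one_le_exp (r ^ 2 / (2 * ε))
      have h6 : Real.exp (-(r ^ 2 / (2 * ε))) ≤ (r ^ 2 / (2 * ε))⁻¹ := by
        rw [Real.exp_neg]
        exact inv_anti₀ (by positivity) (by linarith)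
      refine h6.trans_eq ?_
      rw [← mul_div_assoc, Real.mul_self_sqrt (by have := Real.pi_pos; positivity)]
      field_simp
    rw [div_le_iff₀ Real.pi_pos]
    refine h1.trans ?_
    rw [h2] at h3
    refine le_of_mul_le_mul_left (a := √(2 * Real.pi * ε) / Real.pi) ?_ (by positivity)
    refine (h3.trans (add_le_add le_rfl h4)).trans_eq ?_
    field_simp
  have ha (a : ℝ) (ha : 0 < a) (ha' : a < Real.pi) : 1 / Real.exp 1 * K a / Real.pi ≤ M := by
    have h1 : Continuous fun ε ↦ Real.exp (ε * expCurveLog a) / Real.exp 1 * K a / Real.pi := by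
      fun_prop
    have h2 : Continuous fun ε ↦ M + √(2 * Real.pi * ε) / (Real.pi * r ^ 2) := by fun_prop
    have h3 := le_of_tendsto_of_tendsto
      ((h1.tendsto 0).mono_left (nhdsWithin_le_nhds (s := Ioi 0)))
      ((h2.tendsto 0).mono_left (nhdsWithin_le_nhds (s := Ioi 0)))
      (by filter_upwards [self_mem_nhdsWithin] with ε h using hε a ha ha' ε h)
    simpa using h3
  have h1 := ((hKπ.const_mul (1 / Real.exp 1)).div_const Real.pi)
  rw [mul_div_cancel_right₀ _ Real.pi_pos.ne'] at h1
  refine le_of_tendsto h1 ?_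
  filter_upwards [Ioo_mem_nhdsLT Real.pi_pos] with a h using ha a h.1 h.2

lemma inv_exp_one_le_of_continuousAt {ι : Type*} [Fintype ι] {u : ι → ℝ}
    (hu : ∑ j, u j ^ 2 = 1) {f : ℝ → ℝ}
    (hf : expLaw u = volume.withDensity fun x ↦ ENNReal.ofReal (f x)) (hc : ContinuousAt f 0) :
    1 / Real.exp 1 ≤ f 0 := by
  by_contra! h
  obtain ⟨M, hM, hM'⟩ := exists_between (max_lt h (by positivity : (0 : ℝ) < 1 / Real.exp 1))
  obtain ⟨r, hr, hfM⟩ := Metric.eventually_nhds_iff_ball.1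
    (hc.eventually (gt_mem_nhds ((le_max_left _ _).trans_lt hM)))
  exact hM'.not_ge (inv_exp_one_le_of_expLaw_eq_withDensity hu hf
    ((le_max_right _ _).trans hM.le) hr fun x hx ↦ (hfM x hx).le)

lemma expLawDensity_single (x : ℝ) :
    expLawDensity (fun j : Fin (n + 1) ↦ if j = 0 then 1 else 0) 0 x = scaledExpPDF 1 x := by
  have h : (fun i : Fin n ↦ if (0 : Fin (n + 1)).succAbove i = 0 then (1 : ℝ) else 0) = 0 := by
    ext i
    simp
  rw [expLawDensity, h, expLaw_zero, integral_dirac, if_pos rfl, sub_zero]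

end Density

theorem stmt2 (n : ℕ) (hn : 1 ≤ n) (u : Fin (n + 1) → ℝ) (hu : ∑ j, (u j) ^ 2 = 1) :
    (∃ f : ℝ → ℝ,
      (expProd n).map (fun z => ∑ j, u j * (z j - 1)) =
        volume.withDensity (fun x => ENNReal.ofReal (f x)) ∧
      ContinuousAt f 0 ∧ f 0 ≥ 1 / Real.exp 1) ∧
    ((u = fun j => if j = 0 then 1 else 0) →
      ∀ f : ℝ → ℝ,
        (expProd n).map (fun z => ∑ j, u j * (z j - 1)) =
          volume.withDensity (fun x => ENNReal.ofReal (f x)) →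
        ContinuousAt f 0 → f 0 = 1 / Real.exp 1) := by
  have hlaw : (expProd n).map (fun z => ∑ j, u j * (z j - 1)) = expLaw u := rfl
  rw [hlaw]
  refine ⟨?_, ?_⟩
  · obtain ⟨k, hk⟩ : ∃ k, u k ≠ 0 := by
      by_contra! h
      simp [h] at hu
    have hd := expLaw_eq_withDensity u hk
    have hc := continuousAt_expLawDensity hn u hk
    exact ⟨expLawDensity u k, hd, hc, inv_exp_one_le_of_continuousAt hu hd hc⟩
  · rintro rfl f hf hc
    have hd := expLaw_eq_withDensity (fun j : Fin (n + 1) ↦ if j = 0 then (1 : ℝ) else 0) (k := 0)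
      (by simp)
    simp_rw [expLawDensity_single] at hd
    have hc' : ContinuousAt (scaledExpPDF 1) 0 :=
      continuousAt_scaledExpPDF one_ne_zero (by norm_num)
    have hval : scaledExpPDF 1 0 = 1 / Real.exp 1 := by
      simp [scaledExpPDF, exponentialPDFReal_one, Real.exp_neg]
    have hpos : 0 < scaledExpPDF 1 0 := hval ▸ by positivity
    have heq := hf.symm.trans hd
    have h1 := le_of_withDensity_eq heq hc hc' hpos
    rw [← hval]
    exact le_antisymm (le_of_withDensity_eq heq.symm hc' hc (hpos.trans_le h1)) h1
end

section
/- Let u ∈ ℝ^{n+1} be a unit vector with at least two nonzero entries. Then t ↦ F_u(t) is integrable on the real line, the integral ∫_{−∞}^{+∞} F_u(t) dt is a real number (its imaginary part is 0), and (1/(2π))·∫_{−∞}^{+∞} F_u(t) dt ≥ 1/e. -/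
open MeasureTheory

/-- The function `F_u(t) = ∏ j, e^{i u_j t} / (1 + i u_j t)`. -/
noncomputable def Fchar {m : ℕ} (u : Fin m → ℝ) (t : ℂ) : ℂ :=
  ∏ j, Complex.exp (Complex.I * u j * t) / (1 + Complex.I * u j * t)

section Trigonometry

lemma Real.mul_cos_le_sin_of_nonneg_of_le_pi {x : ℝ} (h0 : 0 ≤ x) (hpi : x ≤ Real.pi) :
    x * Real.cos x ≤ Real.sin x := by
  rcases lt_or_ge x (Real.pi / 2) with h | h
  · have hc : 0 < Real.cos x := Real.cos_pos_of_mem_Ioo ⟨by linarith [Real.pi_pos], h⟩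
    have := Real.le_tan h0 h
    rwa [Real.tan_eq_sin_div_cos, le_div_iff₀ hc] at this
  · have hc : Real.cos x ≤ 0 := Real.cos_nonpos_of_pi_div_two_le_of_le h (by linarith)
    have hs : 0 ≤ Real.sin x := Real.sin_nonneg_of_nonneg_of_le_pi h0 hpi
    nlinarith

lemma Real.mul_sin_le_sin_mul {c x : ℝ} (hc0 : 0 ≤ c) (hc1 : c ≤ 1) (h0 : 0 ≤ x)
    (hpi : x ≤ Real.pi) : c * Real.sin x ≤ Real.sin (c * x) := by
  have := strictConcaveOn_sin_Icc.concaveOn.2 (x := x) (y := 0) ⟨h0, hpi⟩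
    ⟨le_rfl, Real.pi_pos.le⟩ hc0 (sub_nonneg.2 hc1) (by ring)
  simpa using this

lemma Complex.im_mul_cos_sub_re_mul_sin (z : ℂ) (α : ℝ) :
    z.im * Real.cos α - z.re * Real.sin α = ‖z‖ * Real.sin (z.arg - α) := by
  rw [Real.sin_sub, mul_sub, ← mul_assoc, ← mul_assoc, Complex.norm_mul_sin_arg,
    Complex.norm_mul_cos_arg]

lemma Complex.le_arg_of_nonneg {z : ℂ} {α : ℝ} (hz : z ≠ 0) (him : 0 ≤ z.im)
    (hα : α < Real.pi) (h : 0 ≤ z.im * Real.cos α - z.re * Real.sin α) : α ≤ z.arg := by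
  rw [Complex.im_mul_cos_sub_re_mul_sin] at h
  by_contra! hlt
  have h1 : 0 ≤ z.arg := Complex.arg_nonneg_iff.2 him
  have h2 : Real.sin (z.arg - α) < 0 := Real.sin_neg_of_neg_of_neg_pi_lt (by linarith) (by linarith)
  nlinarith [norm_pos_iff.2 hz]

lemma Complex.arg_le_of_nonpos {z : ℂ} {α : ℝ} (hz : z ∈ Complex.slitPlane) (hα : 0 ≤ α)
    (h : z.im * Real.cos α - z.re * Real.sin α ≤ 0) : z.arg ≤ α := by
  rw [Complex.im_mul_cos_sub_re_mul_sin] at h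
  by_contra! hlt
  have h1 : z.arg < Real.pi :=
    (Complex.arg_le_pi z).lt_of_ne (Complex.mem_slitPlane_iff_arg.1 hz).1
  have h2 : 0 < Real.sin (z.arg - α) := Real.sin_pos_of_pos_of_lt_pi (by linarith) (by linarith)
  nlinarith [norm_pos_iff.2 (Complex.slitPlane_ne_zero hz)]

end Trigonometry

section Phase

open Complex Filter Topology ComplexConjugate

variable {ι : Type*} [Fintype ι]

/-- A holomorphic logarithm of `e^{iut} / (1 + iut)`. -/
noncomputable def factorPhase (u : ℝ) (t : ℂ) : ℂ := I * u * t - log (1 + I * u * t)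

/-- A holomorphic logarithm of `∏ j, e^{i u_j t} / (1 + i u_j t)`. -/
noncomputable def phase (u : ι → ℝ) (t : ℂ) : ℂ := ∑ j, factorPhase (u j) t

/-- The negative of the derivative of `phase u`. -/
noncomputable def phaseSlope (u : ι → ℝ) (t : ℂ) : ℂ :=
  ∑ j, ((u j ^ 2 : ℝ) : ℂ) * (t / (1 + I * u j * t))

lemma one_add_re (u : ℝ) (t : ℂ) : (1 + I * u * t).re = 1 - u * t.im := by simp; ring

lemma one_add_im (u : ℝ) (t : ℂ) : (1 + I * u * t).im = u * t.re := by simp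

lemma one_add_mem_slitPlane (u : ℝ) {t : ℂ} (ht : 0 < t.re ∨ t = 0) :
    1 + I * u * t ∈ slitPlane := by
  rcases ht with ht | rfl
  · rcases eq_or_ne u 0 with rfl | hu
    · simp
    · right
      rw [one_add_im]
      exact mul_ne_zero hu ht.ne'
  · simp

lemma factorPhase_zero (u : ℝ) : factorPhase u 0 = 0 := by simp [factorPhase]

lemma phase_zero (u : ι → ℝ) : phase u 0 = 0 := by simp [phase, factorPhase_zero]

lemma factorPhase_im (u : ℝ) (t : ℂ) :
    (factorPhase u t).im = u * t.re - (1 + I * u * t).arg := by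
  simp [factorPhase, log_im]

lemma factorPhase_conj (u : ℝ) {t : ℂ} (ht : 0 < t.re ∨ t = 0) :
    factorPhase u (conj t) = conj (factorPhase (-u) t) := by
  have h := one_add_mem_slitPlane (-u) ht
  have e : 1 + I * u * conj t = conj (1 + I * ((-u : ℝ) : ℂ) * t) := by simp
  rw [factorPhase, e, log_conj _ (mem_slitPlane_iff_arg.1 h).1, factorPhase]
  simp

lemma phase_conj (u : ι → ℝ) {t : ℂ} (ht : 0 < t.re ∨ t = 0) :
    phase u (conj t) = conj (phase (-u) t) := by
  simp only [phase, map_sum, Pi.neg_apply, factorPhase_conj _ ht]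

lemma hasStrictDerivAt_factorPhase (u : ℝ) {t : ℂ} (ht : 0 < t.re ∨ t = 0) :
    HasStrictDerivAt (factorPhase u) (-(((u ^ 2 : ℝ) : ℂ) * (t / (1 + I * u * t)))) t := by
  have h := one_add_mem_slitPlane u ht
  have h0 := slitPlane_ne_zero h
  have h1 : HasStrictDerivAt (fun t : ℂ => I * u * t) (I * u) t := by
    simpa using (hasStrictDerivAt_id t).const_mul (I * (u : ℂ))
  have e : -(((u ^ 2 : ℝ) : ℂ) * (t / (1 + I * u * t))) = I * u - I * u / (1 + I * u * t) := by
    rw [← mul_div_assoc, ← neg_div, sub_eq_add_neg, ← neg_div, ← sub_eq_iff_eq_add, ← sub_div,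
      div_eq_iff h0]
    push_cast
    linear_combination (-(u : ℂ) ^ 2 * t) * I_sq
  rw [e]
  exact h1.sub ((h1.const_add 1).clog h)

lemma hasStrictDerivAt_phase (u : ι → ℝ) {t : ℂ} (ht : 0 < t.re ∨ t = 0) :
    HasStrictDerivAt (phase u) (-phaseSlope u t) t := by
  have := HasStrictDerivAt.fun_sum (u := Finset.univ)
    fun j _ => hasStrictDerivAt_factorPhase (u j) ht
  rwa [Finset.sum_neg_distrib] at this

lemma exp_phase (u : ι → ℝ) {t : ℂ} (ht : 0 < t.re ∨ t = 0) :
    exp (phase u t) = ∏ j, exp (I * u j * t) / (1 + I * u j * t) := by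
  rw [phase, exp_sum]
  refine Finset.prod_congr rfl fun j _ => ?_
  rw [factorPhase, exp_sub, exp_log (slitPlane_ne_zero (one_add_mem_slitPlane _ ht))]

lemma div_one_add_re (u : ℝ) (t : ℂ) :
    (t / (1 + I * u * t)).re = t.re / normSq (1 + I * u * t) := by
  rw [div_re, ← add_div, one_add_re, one_add_im]
  congr 1
  ring

lemma normSq_div_one_add (u : ℝ) {t : ℂ} (ht : 0 < t.re) :
    normSq (t / (1 + I * u * t)) = normSq t / t.re * (t / (1 + I * u * t)).re := by
  rw [div_one_add_re, normSq_div]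
  field_simp

lemma phaseSlope_re_pos {u : ι → ℝ} (hu : ∑ j, u j ^ 2 = 1) {t : ℂ} (ht : 0 < t.re) :
    0 < (phaseSlope u t).re := by
  have hpos : ∀ j, 0 < (t / (1 + I * u j * t)).re := fun j => by
    rw [div_one_add_re]
    exact div_pos ht (normSq_pos.2 (slitPlane_ne_zero (one_add_mem_slitPlane _ (.inl ht))))
  simp only [phaseSlope, re_sum, re_ofReal_mul]
  obtain ⟨j, -, hj⟩ := Finset.exists_ne_zero_of_sum_ne_zero (hu.trans_ne one_ne_zero)
  exact Finset.sum_pos' (fun i _ => mul_nonneg (sq_nonneg _) (hpos i).le)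
    ⟨j, Finset.mem_univ _, mul_pos ((sq_nonneg _).lt_of_ne' hj) (hpos j)⟩

lemma normSq_phaseSlope_le {u : ι → ℝ} (hu : ∑ j, u j ^ 2 = 1) {t : ℂ} (ht : 0 < t.re) :
    normSq (phaseSlope u t) ≤ normSq t / t.re * (phaseSlope u t).re := by
  have h1 : ‖phaseSlope u t‖ ≤ ∑ j, u j ^ 2 * ‖t / (1 + I * u j * t)‖ := by
    refine (norm_sum_le _ _).trans (Finset.sum_le_sum fun j _ => ?_)
    rw [norm_mul, norm_real, Real.norm_of_nonneg (sq_nonneg _)]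
  have h2 : (∑ j, u j ^ 2 * ‖t / (1 + I * u j * t)‖) ^ 2 ≤
      ∑ j, u j ^ 2 * ‖t / (1 + I * u j * t)‖ ^ 2 :=
    Real.pow_arith_mean_le_arith_mean_pow _ _ _ (fun j _ => sq_nonneg _) hu
      (fun j _ => norm_nonneg _) 2
  calc normSq (phaseSlope u t) = ‖phaseSlope u t‖ ^ 2 := normSq_eq_norm_sq _
    _ ≤ (∑ j, u j ^ 2 * ‖t / (1 + I * u j * t)‖) ^ 2 := by gcongr
    _ ≤ ∑ j, u j ^ 2 * ‖t / (1 + I * u j * t)‖ ^ 2 := h2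
    _ = normSq t / t.re * (phaseSlope u t).re := by
      simp only [phaseSlope, re_sum, re_ofReal_mul, ← normSq_eq_norm_sq, normSq_div_one_add _ ht,
        Finset.mul_sum]
      exact Finset.sum_congr rfl fun j _ => by ring

end Phase

section Curve

open Complex Filter Topology ComplexConjugate

variable {ι : Type*} [Fintype ι]

lemma vertical_re (s τ : ℝ) : ((s : ℂ) + τ * I).re = s := by simp

lemma vertical_im (s τ : ℝ) : ((s : ℂ) + τ * I).im = τ := by simp

lemma hasDerivAt_vertical (s τ : ℝ) : HasDerivAt (fun x : ℝ => (s : ℂ) + x * I) I τ := by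
  simpa using ((hasDerivAt_id τ).ofReal_comp.mul_const I).const_add (s : ℂ)

lemma HasDerivAt.complex_re {f : ℝ → ℂ} {f' : ℂ} {x : ℝ} (h : HasDerivAt f f' x) :
    HasDerivAt (fun y => (f y).re) f'.re x :=
  (reCLM.hasFDerivAt (x := f x)).comp_hasDerivAt x h

lemma HasDerivAt.complex_im {f : ℝ → ℂ} {f' : ℂ} {x : ℝ} (h : HasDerivAt f f' x) :
    HasDerivAt (fun y => (f y).im) f'.im x :=
  (imCLM.hasFDerivAt (x := f x)).comp_hasDerivAt x h

lemma hasDerivAt_phase_vertical (u : ι → ℝ) {s : ℝ} (hs : 0 < s) (τ : ℝ) :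
    HasDerivAt (fun x : ℝ => phase u ((s : ℂ) + x * I)) (-phaseSlope u ((s : ℂ) + τ * I) * I) τ :=
  (hasStrictDerivAt_phase u (.inl (by simpa using hs))).hasDerivAt.comp τ (hasDerivAt_vertical s τ)

lemma strictAnti_phase_im {u : ι → ℝ} (hu : ∑ j, u j ^ 2 = 1) {s : ℝ} (hs : 0 < s) :
    StrictAnti fun τ : ℝ => (phase u ((s : ℂ) + τ * I)).im :=
  strictAnti_of_hasDerivAt_neg (fun τ => (hasDerivAt_phase_vertical u hs τ).complex_im)
    fun τ => by simpa using phaseSlope_re_pos hu (t := (s : ℂ) + τ * I) (by simpa using hs)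

lemma conj_vertical (s τ : ℝ) : conj ((s : ℂ) + τ * I) = (s : ℂ) + (-τ : ℝ) * I := by
  simp

lemma phase_im_neg (u : ι → ℝ) {s : ℝ} (hs : 0 < s) (τ : ℝ) :
    (phase u ((s : ℂ) + (-τ : ℝ) * I)).im = -(phase (-u) ((s : ℂ) + τ * I)).im := by
  rw [← conj_vertical, phase_conj u (.inl (by simpa using hs)), conj_im]

lemma one_sub_mul_cot_nonneg {s : ℝ} (hs : 0 < s) (hpi : s < Real.pi) :
    0 ≤ 1 - s * Real.cos s / Real.sin s := by
  rw [sub_nonneg, div_le_one (Real.sin_pos_of_pos_of_lt_pi hs hpi)]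
  exact Real.mul_cos_le_sin_of_nonneg_of_le_pi hs.le hpi.le

lemma factorPhase_im_nonpos {u s : ℝ} (hu : |u| ≤ 1) (hs : 0 < s) (hpi : s < Real.pi) :
    (factorPhase u ((s : ℂ) + (1 - s * Real.cos s / Real.sin s : ℝ) * I)).im ≤ 0 := by
  have hsin := Real.sin_pos_of_pos_of_lt_pi hs hpi
  have hT := one_sub_mul_cot_nonneg hs hpi
  have hTe : Real.sin s * (1 - s * Real.cos s / Real.sin s) = Real.sin s - s * Real.cos s := by
    field_simp
  set T := 1 - s * Real.cos s / Real.sin s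
  have hslit : 1 + I * u * ((s : ℂ) + T * I) ∈ slitPlane :=
    one_add_mem_slitPlane u (.inl (by simpa using hs))
  have him : (1 + I * u * ((s : ℂ) + T * I)).im = u * s := by rw [one_add_im, vertical_re]
  have hre : (1 + I * u * ((s : ℂ) + T * I)).re = 1 - u * T := by rw [one_add_re, vertical_im]
  rw [abs_le] at hu
  rw [factorPhase_im, vertical_re, sub_nonpos]
  rcases le_total 0 u with h0 | h0
  · refine le_arg_of_nonneg (slitPlane_ne_zero hslit) (by rw [him]; positivity) (by nlinarith) ?_
    rw [him, hre]
    have h1 := Real.mul_sin_le_sin_mul (c := 1 - u) (by linarith) (by linarith) hs.le hpi.le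
    have h2 : Real.sin (u * s) ≤ u * s := Real.sin_le (by positivity)
    have h3 : Real.sin ((1 - u) * s) =
        Real.sin s * Real.cos (u * s) - Real.cos s * Real.sin (u * s) := by
      rw [← Real.sin_sub]; ring_nf
    have h4 : Real.sin s * (u * s * Real.cos (u * s) - (1 - u * T) * Real.sin (u * s)) =
        u * s * Real.sin ((1 - u) * s) - (1 - u) * Real.sin s * Real.sin (u * s) := by
      rw [h3]; linear_combination u * Real.sin (u * s) * hTe
    refine (mul_nonneg_iff_of_pos_left hsin).1 (h4 ▸ ?_)
    have h5 : 0 ≤ u * s := by positivity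
    have h6 : 0 ≤ (1 - u) * Real.sin s := mul_nonneg (by linarith) hsin.le
    nlinarith
  · have hc : (conj (1 + I * u * ((s : ℂ) + T * I))).arg ≤ -u * s := by
      refine arg_le_of_nonpos ?_ (by nlinarith) ?_
      · rwa [mem_slitPlane_iff, conj_re, conj_im, neg_ne_zero]
      · rw [conj_re, conj_im, him, hre]
        have h1 := Real.mul_cos_le_sin_of_nonneg_of_le_pi (x := -u * s) (by nlinarith)
          (by nlinarith)
        have h2 : 0 ≤ Real.sin (-u * s) :=
          Real.sin_nonneg_of_nonneg_of_le_pi (by nlinarith) (by nlinarith)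
        have h3 : 0 ≤ -u * T := mul_nonneg (by linarith) hT
        nlinarith
    rw [arg_conj, if_neg (mem_slitPlane_iff_arg.1 hslit).1] at hc
    linarith

lemma abs_le_one_of_sum_sq {u : ι → ℝ} (hu : ∑ j, u j ^ 2 = 1) (j : ι) : |u j| ≤ 1 := by
  rw [← sq_le_one_iff_abs_le_one, ← hu]
  exact Finset.single_le_sum (f := fun j => u j ^ 2) (fun _ _ => sq_nonneg _) (Finset.mem_univ j)

lemma phase_im_nonpos {u : ι → ℝ} (hu : ∑ j, u j ^ 2 = 1) {s : ℝ} (hs : 0 < s)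
    (hpi : s < Real.pi) :
    (phase u ((s : ℂ) + (1 - s * Real.cos s / Real.sin s : ℝ) * I)).im ≤ 0 := by
  rw [phase, im_sum]
  exact Finset.sum_nonpos fun j _ => factorPhase_im_nonpos (abs_le_one_of_sum_sq hu j) hs hpi

lemma abs_le_of_phase_im_eq_zero {u : ι → ℝ} (hu : ∑ j, u j ^ 2 = 1) {s τ : ℝ} (hs : 0 < s)
    (hpi : s < Real.pi) (h : (phase u ((s : ℂ) + τ * I)).im = 0) :
    |τ| ≤ 1 - s * Real.cos s / Real.sin s := by
  have hu' : ∑ j, (-u) j ^ 2 = 1 := by simpa using hu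
  have anti := strictAnti_phase_im hu hs
  rw [abs_le]
  constructor
  · refine anti.le_iff_ge.1 ?_
    rw [h, phase_im_neg u hs]
    linarith [phase_im_nonpos hu' hs hpi]
  · refine anti.le_iff_ge.1 ?_
    rw [h]
    exact phase_im_nonpos hu hs hpi

lemma tendsto_factorPhase_im (u : ℝ) {s : ℝ} (hs : 0 < s) :
    Tendsto (fun τ : ℝ => (factorPhase u ((s : ℂ) + τ * I)).im) atTop
      (𝓝 (u * s - if 0 < u then Real.pi else 0)) := by
  simp only [factorPhase_im, vertical_re]
  refine tendsto_const_nhds.sub ?_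
  have hw : Tendsto (fun τ : ℝ => (τ⁻¹ : ℝ) * (1 + I * u * ((s : ℂ) + τ * I))) atTop
      (𝓝 (-(u : ℂ))) := by
    have h1 : Tendsto (fun τ : ℝ => ((τ⁻¹ : ℝ) : ℂ) * (1 + I * u * s) - u) atTop
        (𝓝 (((0 : ℝ) : ℂ) * (1 + I * u * s) - u)) :=
      ((continuous_ofReal.tendsto _ |>.comp tendsto_inv_atTop_zero).mul_const _).sub_const _
    rw [ofReal_zero, zero_mul, zero_sub] at h1
    refine h1.congr' ?_
    filter_upwards [eventually_gt_atTop 0] with τ hτ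
    have : (τ : ℂ) ≠ 0 := ofReal_ne_zero.2 hτ.ne'
    push_cast
    field_simp
    linear_combination (-(u : ℂ) * τ) * I_sq
  have harg : (fun τ : ℝ => ((τ⁻¹ : ℝ) * (1 + I * u * ((s : ℂ) + τ * I))).arg) =ᶠ[atTop]
      fun τ : ℝ => (1 + I * u * ((s : ℂ) + τ * I)).arg := by
    filter_upwards [eventually_gt_atTop 0] with τ hτ
    exact arg_real_mul _ (inv_pos.2 hτ)
  refine Tendsto.congr' harg ?_
  split_ifs with h
  · have hc := continuousWithinAt_arg_of_re_neg_of_im_zero (z := -(u : ℂ)) (by simpa) (by simp)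
    have := hc.tendsto.comp (tendsto_nhdsWithin_iff.2 ⟨hw, ?_⟩)
    · rwa [← ofReal_neg, arg_ofReal_of_neg (by linarith)] at this
    · filter_upwards [eventually_gt_atTop 0] with τ hτ
      rw [im_ofReal_mul, one_add_im, vertical_re]
      positivity
  · rcases eq_or_lt_of_le (not_lt.1 h) with rfl | h
    · refine tendsto_const_nhds.congr' ?_
      filter_upwards [eventually_gt_atTop 0] with τ hτ
      rw [arg_real_mul _ (inv_pos.2 hτ)]
      simp
    · have hc : ContinuousAt arg (-(u : ℂ)) := continuousAt_arg (.inl (by simpa))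
      have := hc.tendsto.comp hw
      rwa [← ofReal_neg, arg_ofReal_of_nonneg (by linarith)] at this

lemma exists_phase_im_neg {u : ι → ℝ} (hu : ∑ j, u j ^ 2 = 1) (hsum : ∑ j, u j = 0) {s : ℝ}
    (hs : 0 < s) : ∃ τ : ℝ, (phase u ((s : ℂ) + τ * I)).im < 0 := by
  have hpos : ∃ j ∈ Finset.univ, 0 < u j := by
    by_contra! h
    have h0 := (Finset.sum_eq_zero_iff_of_nonpos h).1 hsum
    rw [Finset.sum_eq_zero fun j hj => by rw [h0 j hj]; ring] at hu
    exact zero_ne_one hu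
  obtain ⟨j, hj, hj0⟩ := hpos
  have hlim : Tendsto (fun τ : ℝ => (phase u ((s : ℂ) + τ * I)).im) atTop
      (𝓝 (∑ j, (u j * s - if 0 < u j then Real.pi else 0))) := by
    simp only [phase, im_sum]
    exact tendsto_finsetSum _ fun j _ => tendsto_factorPhase_im (u j) hs
  refine (hlim.eventually_lt_const ?_).exists
  rw [Finset.sum_sub_distrib, ← Finset.sum_mul, hsum, zero_mul, zero_sub, neg_lt_zero]
  exact Finset.sum_pos' (fun i _ => by split_ifs <;> positivity)
    ⟨j, hj, by rw [if_pos hj0]; exact Real.pi_pos⟩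

lemma exists_phase_im_eq_zero {u : ι → ℝ} (hu : ∑ j, u j ^ 2 = 1) (hsum : ∑ j, u j = 0) {s : ℝ}
    (hs : 0 < s) : ∃ τ : ℝ, (phase u ((s : ℂ) + τ * I)).im = 0 := by
  obtain ⟨a, ha⟩ := exists_phase_im_neg hu hsum hs
  obtain ⟨b, hb⟩ := exists_phase_im_neg (u := -u) (by simpa using hu) (by simpa using hsum) hs
  have hcont : Continuous fun τ : ℝ => (phase u ((s : ℂ) + τ * I)).im :=
    continuous_iff_continuousAt.2 fun τ => (hasDerivAt_phase_vertical u hs τ).complex_im.continuousAt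
  refine mem_range_of_exists_le_of_exists_ge hcont ⟨a, ha.le⟩ ⟨-b, ?_⟩
  rw [phase_im_neg u hs]
  linarith

/-- The contour `s ↦ s + i τ(s)`, `s ≥ 0`, starts at `0` and `phase u` is real along it. -/
structure IsRealContour (u : ι → ℝ) (τ : ℝ → ℝ) : Prop where
  zero : τ 0 = 0
  im_eq_zero : ∀ s : ℝ, 0 < s → (phase u ((s : ℂ) + τ s * I)).im = 0

lemma exists_isRealContour {u : ι → ℝ} (hu : ∑ j, u j ^ 2 = 1) (hsum : ∑ j, u j = 0) :
    ∃ τ, IsRealContour u τ := by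
  choose! τ hτ using fun s (hs : (0 : ℝ) < s) => exists_phase_im_eq_zero hu hsum hs
  refine ⟨fun s => if s = 0 then 0 else τ s, by simp, fun s hs => ?_⟩
  rw [if_neg hs.ne']
  exact hτ s hs

namespace IsRealContour

variable {u : ι → ℝ} {τ : ℝ → ℝ}

lemma hasDerivAt_path {s d : ℝ} (h : HasDerivAt τ d s) :
    HasDerivAt (fun x : ℝ => (x : ℂ) + τ x * I) (1 + d * I) s :=
  (hasDerivAt_id s).ofReal_comp.add (h.ofReal_comp.mul_const I)

lemma differentiableAt (hτ : IsRealContour u τ) (hu : ∑ j, u j ^ 2 = 1) {s : ℝ} (hs : 0 < s) :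
    DifferentiableAt ℝ τ s := by
  set t : ℂ := (s : ℂ) + τ s * I with ht
  have hre : 0 < t.re := by simpa [ht] using hs
  let f : ℝ × ℝ → ℝ := fun v => (phase u ((v.1 : ℂ) + v.2 * I)).im
  let L : ℝ × ℝ →L[ℝ] ℂ := ofRealCLM.comp (.fst ℝ ℝ ℝ) + (I • ofRealCLM).comp (.snd ℝ ℝ ℝ)
  have hL : ∀ v, L v = (v.1 : ℂ) + v.2 * I := fun v => by simp [L, mul_comm]
  have hf : HasStrictFDerivAt f
      (imCLM.comp ((((ContinuousLinearMap.toSpanSingleton ℂ (-phaseSlope u t)).restrictScalars ℝ)).comp L))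
      (s, τ s) := by
    have h1 : HasStrictFDerivAt (phase u)
        ((ContinuousLinearMap.toSpanSingleton ℂ (-phaseSlope u t)).restrictScalars ℝ) (L (s, τ s)) := by
      rw [hL]
      exact (hasStrictDerivAt_phase u (.inl hre)).hasStrictFDerivAt.restrictScalars ℝ
    have := imCLM.hasStrictFDerivAt.comp _ (h1.comp (s, τ s) L.hasStrictFDerivAt)
    have e : f = fun x => imCLM (phase u (L x)) := by
      funext v
      simp only [f, hL, imCLM_apply]
    rw [e]
    exact this
  have hinv : ((imCLM.comp ((((ContinuousLinearMap.toSpanSingleton ℂ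
      (-phaseSlope u t)).restrictScalars ℝ)).comp L)) ∘L (.inr ℝ ℝ ℝ)).IsInvertible := by
    refine ⟨ContinuousLinearEquiv.unitsEquivAut ℝ (Units.mk0 (-(phaseSlope u t).re)
      (neg_ne_zero.2 (phaseSlope_re_pos hu hre).ne')), ?_⟩
    ext
    simp [L]
  have hev := hf.eventually_apply_implicitFunctionOfProdDomain hinv
  have heq : τ =ᶠ[𝓝 s] hf.implicitFunctionOfProdDomain hinv := by
    filter_upwards [hev, eventually_gt_nhds hs] with x hx hx0
    refine (strictAnti_phase_im hu hx0).injective ?_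
    exact ((hτ.im_eq_zero x hx0).trans (hτ.im_eq_zero s hs).symm).trans hx.symm
  exact (hf.hasStrictFDerivAt_implicitFunctionOfProdDomain hinv).differentiableAt.congr_of_eventuallyEq
    heq

end IsRealContour

end Curve

section LowerBound

open Complex Filter Topology ComplexConjugate

variable {ι : Type*} [Fintype ι]

lemma tendsto_sin_div_nhdsGT_zero : Tendsto (fun s : ℝ => Real.sin s / s) (𝓝[>] 0) (𝓝 1) := by
  have h : Tendsto Real.sinc (𝓝[>] 0) (𝓝 1) := by
    simpa using (Real.continuous_sinc.tendsto 0).mono_left nhdsWithin_le_nhds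
  refine h.congr' ?_
  filter_upwards [self_mem_nhdsWithin] with s hs
  exact Real.sinc_of_ne_zero (ne_of_gt hs)

lemma tendsto_mul_cot_nhdsGT_zero :
    Tendsto (fun s : ℝ => s * Real.cos s / Real.sin s) (𝓝[>] 0) (𝓝 1) := by
  have hc : Tendsto Real.cos (𝓝[>] 0) (𝓝 1) := by
    simpa using (Real.continuous_cos.tendsto 0).mono_left nhdsWithin_le_nhds
  have := hc.div tendsto_sin_div_nhdsGT_zero one_ne_zero
  rw [div_one] at this
  refine this.congr fun s => ?_
  rw [Pi.div_apply, div_div_eq_mul_div, mul_comm]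

lemma tendsto_mul_cot_nhdsLT_pi :
    Tendsto (fun s : ℝ => s * Real.cos s / Real.sin s) (𝓝[<] Real.pi) atBot := by
  have hnum : Tendsto (fun s : ℝ => s * Real.cos s) (𝓝[<] Real.pi) (𝓝 (-Real.pi)) := by
    have : Continuous fun s : ℝ => s * Real.cos s := by fun_prop
    simpa using (this.tendsto Real.pi).mono_left nhdsWithin_le_nhds
  have hden : Tendsto Real.sin (𝓝[<] Real.pi) (𝓝[>] 0) := by
    refine tendsto_nhdsWithin_iff.2 ⟨?_, ?_⟩
    · simpa using (Real.continuous_sin.tendsto Real.pi).mono_left nhdsWithin_le_nhds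
    · filter_upwards [Ioo_mem_nhdsLT Real.pi_pos] with s hs
      exact Real.sin_pos_of_pos_of_lt_pi hs.1 hs.2
  simp only [div_eq_mul_inv]
  exact hnum.neg_mul_atTop (by linarith [Real.pi_pos]) (tendsto_inv_nhdsGT_zero.comp hden)

lemma hasDerivAt_mul_cot {s : ℝ} (hs : Real.sin s ≠ 0) :
    HasDerivAt (fun x : ℝ => x * Real.cos x / Real.sin x)
      (Real.cos s / Real.sin s - s / Real.sin s ^ 2) s := by
  refine (((hasDerivAt_id' s).fun_mul (Real.hasDerivAt_cos s)).fun_div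
    (Real.hasDerivAt_sin s) hs).congr_deriv ?_
  field_simp
  linear_combination (-s) * Real.sin_sq_add_cos_sq s

/-- An entire primitive of `(e^w - 1) / w`, normalized to vanish at `1`. -/
lemma exists_primitive_exp_sub_one_div : ∃ E : ℂ → ℂ,
    E 1 = 0 ∧ ∀ w, HasDerivAt E (dslope exp 0 w) w := by
  have h : Differentiable ℂ (dslope exp 0) := by
    rw [← differentiableOn_univ, differentiableOn_dslope univ_mem]
    exact differentiable_exp.differentiableOn
  obtain ⟨E, hE1, hE⟩ := h.isExactOn_univ.with_val_at 1 0
  exact ⟨E, hE1, fun w => hE w trivial⟩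

lemma dslope_exp_of_ne {w : ℂ} (hw : w ≠ 0) : dslope exp 0 w = (exp w - 1) / w := by
  rw [dslope_of_ne _ hw, slope_def_field, exp_zero, sub_zero]

lemma primitive_im_ofReal {E : ℂ → ℂ} (hE1 : E 1 = 0)
    (hE : ∀ w, HasDerivAt E (dslope exp 0 w) w) (x : ℝ) : (E x).im = 0 := by
  have h : ∀ y : ℝ, HasDerivAt (fun y : ℝ => (E y).im) 0 y := fun y => by
    have h1 := ((hE y).comp_ofReal).complex_im
    have h2 : (dslope exp 0 (y : ℂ)).im = 0 := by
      rcases eq_or_ne y 0 with rfl | hy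
      · simp [dslope_same]
      · rw [dslope_exp_of_ne (ofReal_ne_zero.2 hy), ← ofReal_exp, ← ofReal_one, ← ofReal_sub,
          ← ofReal_div, ofReal_im]
    rwa [h2] at h1
  have := is_const_of_deriv_eq_zero (fun y => (h y).differentiableAt) (fun y => (h y).deriv) x 1
  simpa [hE1] using this

lemma norm_primitive_sub_le {E : ℂ → ℂ} (hE : ∀ w, HasDerivAt E (dslope exp 0 w) w) {x : ℝ}
    (hx : x < 0) (y : ℝ) : ‖E ((x : ℂ) + y * I) - E x‖ ≤ 2 / |x| * |y| := by
  have hb : ∀ w ∈ {w : ℂ | w.re ≤ x}, ‖dslope exp 0 w‖ ≤ 2 / |x| := fun w hw => by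
    replace hw : w.re ≤ x := hw
    have hw0 : w ≠ 0 := by rintro rfl; exact absurd hw (by simpa using hx)
    rw [dslope_exp_of_ne hw0, norm_div]
    have h1 : ‖exp w - 1‖ ≤ 2 := by
      refine (norm_sub_le _ _).trans ?_
      rw [norm_exp, norm_one]
      linarith [Real.exp_le_one_iff.2 (hw.trans hx.le)]
    have h2 : |x| ≤ ‖w‖ := by
      refine le_trans ?_ (abs_re_le_norm w)
      rw [abs_of_neg hx, abs_of_nonpos (hw.trans hx.le)]
      linarith
    have : 0 < |x| := abs_pos.2 hx.ne
    gcongr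
  have := (convex_halfSpace_re_le x).norm_image_sub_le_of_norm_hasDerivWithin_le
    (fun w _ => (hE w).hasDerivWithinAt) hb (x := (x : ℂ)) (y := (x : ℂ) + y * I)
    (by simp) (by simp)
  simpa using this

/-- A primitive of the value `e^{s cot s} sin s / s` of the extremal integrand. -/
lemma exists_primitive_extremal : ∃ Q : ℝ → ℝ,
    (∀ s, 0 < s → s < Real.pi →
      HasDerivAt Q (Real.exp (s * Real.cos s / Real.sin s) * (Real.sin s / s)) s) ∧
    Tendsto Q (𝓝[>] 0) (𝓝 0) ∧ Tendsto Q (𝓝[<] Real.pi) (𝓝 Real.pi) := by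
  obtain ⟨E, hE1, hE⟩ := exists_primitive_exp_sub_one_div
  let w : ℝ → ℂ := fun s => (s * Real.cos s / Real.sin s : ℝ) + s * I
  have w_def : ∀ s, w s = (s * Real.cos s / Real.sin s : ℝ) + s * I := fun _ => rfl
  refine ⟨fun s => s + (E (w s)).im, fun s hs hpi => ?_, ?_, ?_⟩
  · have hsin := Real.sin_pos_of_pos_of_lt_pi hs hpi
    set c := s * Real.cos s / Real.sin s with hc
    set c' := Real.cos s / Real.sin s - s / Real.sin s ^ 2 with hc'
    have hw : HasDerivAt w (c' + I) s := by
      have h1 := (hasDerivAt_mul_cot hsin.ne').ofReal_comp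
      have h2 : HasDerivAt (fun x : ℝ => (x : ℂ) * I) I s := by
        simpa using (hasDerivAt_id s).ofReal_comp.mul_const I
      exact h1.add h2
    have hinv : (w s)⁻¹ = (Real.sin s / s : ℝ) * (Real.cos s - Real.sin s * I) := by
      refine inv_eq_of_mul_eq_one_right ?_
      have hs' : (s : ℂ) ≠ 0 := ofReal_ne_zero.2 hs.ne'
      have hsin' : ((Real.sin s : ℝ) : ℂ) ≠ 0 := ofReal_ne_zero.2 hsin.ne'
      have hsq : ((Real.sin s : ℝ) : ℂ) ^ 2 + ((Real.cos s : ℝ) : ℂ) ^ 2 = 1 := by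
        exact_mod_cast Real.sin_sq_add_cos_sq s
      simp only [w]
      rw [ofReal_div, ofReal_div, ofReal_mul]
      field_simp
      linear_combination hsq - ((Real.sin s : ℝ) : ℂ) ^ 2 * I_sq
    have hexp : exp (w s) = Real.exp c * (Real.cos s + Real.sin s * I) := by
      simp only [w]
      rw [exp_add, exp_mul_I, ofReal_exp, ofReal_cos, ofReal_sin]
    have hw0 : w s ≠ 0 := fun h => by
      have : (w s).im = s := vertical_im _ _
      rw [h, zero_im] at this
      exact hs.ne this
    refine ((hasDerivAt_id' s).add ((hE (w s)).comp s hw).complex_im).congr_deriv ?_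
    have hval : (exp (w s) - 1) * (w s)⁻¹ * (c' + I) =
        (Real.exp c * (Real.sin s / s) : ℝ) * (c' + I) -
          (Real.sin s / s : ℝ) * ((Real.cos s - Real.sin s * I) * (c' + I)) := by
      have hsq : ((Real.sin s : ℝ) : ℂ) ^ 2 + ((Real.cos s : ℝ) : ℂ) ^ 2 = 1 := by
        exact_mod_cast Real.sin_sq_add_cos_sq s
      rw [hinv, hexp, ofReal_mul]
      linear_combination (Real.exp c : ℂ) * ((Real.sin s / s : ℝ) : ℂ) * (c' + I) *
        (hsq - ((Real.sin s : ℝ) : ℂ) ^ 2 * I_sq)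
    rw [dslope_exp_of_ne hw0, div_eq_mul_inv, hval, sub_im, im_ofReal_mul, im_ofReal_mul]
    simp only [mul_im, add_re, ofReal_re, I_re, add_im, ofReal_im, I_im, sub_re, sub_im, mul_re]
    rw [hc']
    field_simp
    ring
  · have hw : Tendsto w (𝓝[>] 0) (𝓝 1) := by
      have h1 := (continuous_ofReal.tendsto _).comp tendsto_mul_cot_nhdsGT_zero
      have h2 : Tendsto (fun s : ℝ => (s : ℂ) * I) (𝓝[>] 0) (𝓝 0) := by
        have : Continuous fun s : ℝ => (s : ℂ) * I := by fun_prop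
        simpa using (this.tendsto 0).mono_left nhdsWithin_le_nhds
      have h := h1.add h2
      rw [ofReal_one, add_zero] at h
      exact h
    have h1 := (continuous_im.tendsto _).comp (((hE 1).continuousAt.tendsto).comp hw)
    have h2 : Tendsto (fun s : ℝ => s) (𝓝[>] 0) (𝓝 0) := tendsto_id.mono_left nhdsWithin_le_nhds
    simpa [hE1] using h2.add h1
  · have h2 : Tendsto (fun s : ℝ => s) (𝓝[<] Real.pi) (𝓝 Real.pi) :=
      tendsto_id.mono_left nhdsWithin_le_nhds
    have h3 : Tendsto (fun s : ℝ => 2 / |s * Real.cos s / Real.sin s| * |s|) (𝓝[<] Real.pi)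
        (𝓝 (0 * |Real.pi|)) :=
      ((tendsto_abs_atBot_atTop.comp tendsto_mul_cot_nhdsLT_pi).const_div_atTop 2).mul h2.abs
    rw [zero_mul] at h3
    have h4 : Tendsto (fun s => (E (w s)).im) (𝓝[<] Real.pi) (𝓝 0) := by
      refine squeeze_zero_norm' ?_ h3
      filter_upwards [tendsto_mul_cot_nhdsLT_pi.eventually_lt_atBot 0] with s hs
      refine le_trans ?_ (norm_primitive_sub_le hE hs s)
      have : (E (w s)).im = (E (w s) - E (s * Real.cos s / Real.sin s : ℝ)).im := by
        rw [sub_im, primitive_im_ofReal hE1 hE, sub_zero]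
      rw [this]
      exact abs_im_le_norm _
    simpa using h2.add h4

namespace IsRealContour

variable {u : ι → ℝ} {τ : ℝ → ℝ}

lemma tendsto_zero (hτ : IsRealContour u τ) (hu : ∑ j, u j ^ 2 = 1) :
    Tendsto τ (𝓝[>] 0) (𝓝 0) := by
  refine squeeze_zero_norm' (a := fun s => 1 - s * Real.cos s / Real.sin s) ?_ ?_
  · filter_upwards [Ioo_mem_nhdsGT Real.pi_pos] with s hs
    exact abs_le_of_phase_im_eq_zero hu hs.1 hs.2 (hτ.im_eq_zero s hs.1)
  · simpa using tendsto_mul_cot_nhdsGT_zero.const_sub 1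

lemma tendsto_path_zero (hτ : IsRealContour u τ) (hu : ∑ j, u j ^ 2 = 1) :
    Tendsto (fun s : ℝ => (s : ℂ) + τ s * I) (𝓝[>] 0) (𝓝 0) := by
  have h1 : Tendsto (fun s : ℝ => (s : ℂ)) (𝓝[>] 0) (𝓝 ((0 : ℝ) : ℂ)) :=
    (continuous_ofReal.tendsto 0).mono_left nhdsWithin_le_nhds
  have h2 := ((continuous_ofReal.tendsto _).comp (hτ.tendsto_zero hu)).mul_const I
  simpa using h1.add h2

lemma continuousOn_path (hτ : IsRealContour u τ) (hu : ∑ j, u j ^ 2 = 1) :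
    ContinuousOn (fun s : ℝ => (s : ℂ) + τ s * I) (Set.Ici 0) := by
  intro s hs
  rcases eq_or_lt_of_le (Set.mem_Ici.1 hs) with rfl | hs
  · rw [← continuousWithinAt_Ioi_iff_Ici, ContinuousWithinAt]
    simpa [hτ.zero] using hτ.tendsto_path_zero hu
  · exact (hasDerivAt_path
      (hτ.differentiableAt hu hs).hasDerivAt).continuousAt.continuousWithinAt

lemma neg_normSq_div_le (hτ : IsRealContour u τ) (hu : ∑ j, u j ^ 2 = 1) {s : ℝ} (hs : 0 < s) :
    ∃ d, HasDerivAt (fun x : ℝ => (phase u ((x : ℂ) + τ x * I)).re) d s ∧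
      -((s ^ 2 + τ s ^ 2) / s) ≤ d := by
  set t : ℂ := (s : ℂ) + τ s * I with ht
  have hre : t.re = s := vertical_re _ _
  have him : t.im = τ s := vertical_im _ _
  have hre0 : 0 < t.re := hre ▸ hs
  have hpath := hasDerivAt_path (hτ.differentiableAt hu hs).hasDerivAt
  set d := deriv τ s
  have hd : HasDerivAt (fun x : ℝ => phase u ((x : ℂ) + τ x * I))
      (-phaseSlope u t * (1 + d * I)) s :=
    HasDerivAt.comp (h := fun x : ℝ => (x : ℂ) + τ x * I) s
      (hasStrictDerivAt_phase u (.inl hre0)).hasDerivAt hpath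
  refine ⟨_, hd.complex_re, ?_⟩
  have him0 : (-phaseSlope u t * (1 + d * I)).im = 0 := by
    refine hd.complex_im.unique ((hasDerivAt_const s (0 : ℝ)).congr_of_eventuallyEq ?_)
    filter_upwards [eventually_gt_nhds hs] with x hx using hτ.im_eq_zero x hx
  have hA := phaseSlope_re_pos hu hre0
  have hB := normSq_phaseSlope_le hu hre0
  rw [hre, normSq_apply, normSq_apply, hre, him] at hB
  simp only [neg_mul, neg_im, neg_re, mul_im, mul_re, add_re, one_re, ofReal_re, ofReal_im, I_re,
    I_im, add_im, one_im] at him0 ⊢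
  set a := (phaseSlope u t).re
  set b := (phaseSlope u t).im
  have hd' : d * a = -b := by linarith
  have h1 : (s ^ 2 + τ s ^ 2) / s * a = (s * s + τ s * τ s) / s * a := by ring
  rw [neg_le, ← mul_le_mul_iff_left₀ hA, h1]
  refine le_trans (le_of_eq ?_) hB
  linear_combination (-b) * hd'

lemma le_re_phase (hτ : IsRealContour u τ) (hu : ∑ j, u j ^ 2 = 1) {s : ℝ} (hs : 0 < s)
    (hpi : s < Real.pi) :
    s * Real.cos s / Real.sin s - 1 + Real.log (Real.sin s / s) ≤
      (phase u ((s : ℂ) + τ s * I)).re := by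
  let D : ℝ → ℝ := fun s => (phase u ((s : ℂ) + τ s * I)).re -
    (s * Real.cos s / Real.sin s - 1 + Real.log (Real.sin s / s))
  have hD : ∀ x ∈ Set.Ioo 0 Real.pi, ∃ d, HasDerivAt D d x ∧ 0 ≤ d := by
    rintro x ⟨hx, hxpi⟩
    obtain ⟨d, hd, hle⟩ := hτ.neg_normSq_div_le hu hx
    have hsin := Real.sin_pos_of_pos_of_lt_pi hx hxpi
    have hlog := ((Real.hasDerivAt_sin x).fun_div (hasDerivAt_id' x) hx.ne').log
      (div_pos hsin hx).ne'
    refine ⟨_, hd.sub (((hasDerivAt_mul_cot hsin.ne').sub_const 1).add hlog), ?_⟩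
    have hb := abs_le_of_phase_im_eq_zero hu hx hxpi (hτ.im_eq_zero x hx)
    have hsq : τ x ^ 2 ≤ (1 - x * Real.cos x / Real.sin x) ^ 2 := sq_le_sq' (by
      linarith [neg_abs_le (τ x)]) (by linarith [le_abs_self (τ x)])
    have h1 : (x ^ 2 + τ x ^ 2) / x ≤ (x ^ 2 + (1 - x * Real.cos x / Real.sin x) ^ 2) / x := by
      gcongr
    have h2 : Real.cos x / Real.sin x - x / Real.sin x ^ 2 +
        (Real.cos x * x - Real.sin x * 1) / x ^ 2 / (Real.sin x / x) =
        -((x ^ 2 + (1 - x * Real.cos x / Real.sin x) ^ 2) / x) := by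
      field_simp
      linear_combination x ^ 2 * Real.sin_sq_add_cos_sq x
    rw [h2]
    linarith
  have hmono : MonotoneOn D (Set.Ioo 0 Real.pi) := by
    refine monotoneOn_of_deriv_nonneg (convex_Ioo _ _)
      (fun x hx => (hD x hx).choose_spec.1.continuousAt.continuousWithinAt) ?_ ?_ <;>
    rw [interior_Ioo]
    · exact fun x hx => (hD x hx).choose_spec.1.differentiableAt.differentiableWithinAt
    · intro x hx
      rw [(hD x hx).choose_spec.1.deriv]
      exact (hD x hx).choose_spec.2
  have hlim : Tendsto D (𝓝[>] 0) (𝓝 0) := by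
    have h1 : Tendsto (fun s : ℝ => (phase u ((s : ℂ) + τ s * I)).re) (𝓝[>] 0) (𝓝 0) := by
      have := (hasStrictDerivAt_phase u (.inr rfl)).hasDerivAt.continuousAt.tendsto.comp
        (hτ.tendsto_path_zero hu)
      have h := (continuous_re.tendsto _).comp this
      rwa [phase_zero, zero_re] at h
    have h2 := (Real.continuousAt_log one_ne_zero).tendsto.comp tendsto_sin_div_nhdsGT_zero
    simpa using h1.sub ((tendsto_mul_cot_nhdsGT_zero.sub_const 1).add h2)
  have h0 : 0 ≤ D s := by
    refine le_of_tendsto hlim ?_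
    filter_upwards [Ioo_mem_nhdsGT hs] with x hx
    exact hmono ⟨hx.1, hx.2.trans hpi⟩ ⟨hs, hpi⟩ hx.2.le
  exact sub_nonneg.1 h0

end IsRealContour

end LowerBound

section Integrand

open Complex Filter Topology ComplexConjugate

variable {ι : Type*} [Fintype ι]

/-- The function `∏ j, e^{i u_j t} / (1 + i u_j t)`, for an arbitrary finite index type. -/
noncomputable def simplexChar (u : ι → ℝ) (t : ℂ) : ℂ :=
  ∏ j, exp (I * u j * t) / (1 + I * u j * t)

lemma norm_simplexChar (u : ι → ℝ) (t : ℂ) :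
    ‖simplexChar u t‖ = Real.exp (-((∑ j, u j) * t.im)) * ∏ j, ‖1 + I * u j * t‖⁻¹ := by
  have h : ∀ j, ‖exp (I * u j * t) / (1 + I * u j * t)‖ =
      Real.exp (-(u j * t.im)) * ‖1 + I * u j * t‖⁻¹ := fun j => by
    rw [norm_div, norm_exp, div_eq_mul_inv]
    congr 2
    simp
  rw [simplexChar, norm_prod, Finset.prod_congr rfl fun j _ => h j, Finset.prod_mul_distrib,
    ← Real.exp_sum, Finset.sum_neg_distrib, Finset.sum_mul]

lemma differentiableAt_simplexChar {u : ι → ℝ} {t : ℂ} (ht : ∀ j, 1 + I * u j * t ≠ 0) :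
    DifferentiableAt ℂ (simplexChar u) t := by
  unfold simplexChar
  refine DifferentiableAt.fun_finsetProd fun j _ => ?_
  exact DifferentiableAt.div (by fun_prop) (by fun_prop) (ht j)

lemma one_le_norm_one_add_ofReal (u t : ℝ) : 1 ≤ ‖1 + I * u * t‖ := by
  refine le_trans (le_of_eq ?_) (abs_re_le_norm _)
  rw [one_add_re, ofReal_im, mul_zero, sub_zero, abs_one]

lemma one_add_ofReal_ne_zero (u t : ℝ) : 1 + I * u * t ≠ 0 :=
  norm_pos_iff.1 (one_pos.trans_le (one_le_norm_one_add_ofReal u t))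

lemma norm_sq_one_add (u : ℝ) (t : ℂ) :
    ‖1 + I * u * t‖ ^ 2 = (1 - u * t.im) ^ 2 + (u * t.re) ^ 2 := by
  rw [← normSq_eq_norm_sq, normSq_apply, one_add_re, one_add_im]
  ring

lemma continuous_simplexChar_ofReal (u : ι → ℝ) :
    Continuous fun t : ℝ => simplexChar u t :=
  continuous_iff_continuousAt.2 fun t => ContinuousAt.comp (g := simplexChar u)
    (differentiableAt_simplexChar fun j => one_add_ofReal_ne_zero (u j) t).continuousAt
    continuous_ofReal.continuousAt

lemma simplexChar_neg (u : ι → ℝ) (t : ℝ) :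
    simplexChar u ((-t : ℝ) : ℂ) = conj (simplexChar u t) := by
  unfold simplexChar
  rw [map_prod]
  refine Finset.prod_congr rfl fun j _ => ?_
  rw [map_div₀, ← exp_conj]
  simp

lemma Finset.prod_inv_le_add_inv_sq_div_two {a : ι → ℝ} (ha : ∀ i, 1 ≤ a i) {j k : ι}
    (hjk : j ≠ k) : ∏ i, (a i)⁻¹ ≤ ((a j ^ 2)⁻¹ + (a k ^ 2)⁻¹) / 2 := by
  classical
  have h0 : ∀ i, 0 ≤ (a i)⁻¹ := fun i => inv_nonneg.2 (zero_le_one.trans (ha i))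
  rw [← Finset.mul_prod_erase _ _ (Finset.mem_univ j),
    ← Finset.mul_prod_erase _ _ (Finset.mem_erase.2 ⟨hjk.symm, Finset.mem_univ k⟩), ← mul_assoc,
    ← inv_pow, ← inv_pow]
  have h1 : ∏ i ∈ (Finset.univ.erase j).erase k, (a i)⁻¹ ≤ 1 :=
    Finset.prod_le_one (fun i _ => h0 i) fun i _ => inv_le_one_of_one_le₀ (ha i)
  have h2 := mul_le_mul_of_nonneg_left h1 (mul_nonneg (h0 j) (h0 k))
  linarith [two_mul_le_add_sq (a j)⁻¹ (a k)⁻¹]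

lemma norm_simplexChar_ofReal_le (u : ι → ℝ) {j k : ι} (hjk : j ≠ k) (t : ℝ) :
    ‖simplexChar u t‖ ≤ ((1 + (u j * t) ^ 2)⁻¹ + (1 + (u k * t) ^ 2)⁻¹) / 2 := by
  rw [norm_simplexChar, ofReal_im, mul_zero, neg_zero, Real.exp_zero, one_mul]
  refine (Finset.prod_inv_le_add_inv_sq_div_two
    (fun i => one_le_norm_one_add_ofReal (u i) t) hjk).trans_eq ?_
  simp only [norm_sq_one_add, ofReal_im, ofReal_re]
  ring_nf

lemma integrable_simplexChar {u : ι → ℝ} {j k : ι} (hjk : j ≠ k) (hj : u j ≠ 0) (hk : u k ≠ 0) :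
    Integrable fun t : ℝ => simplexChar u t := by
  refine Integrable.mono' (((integrable_inv_one_add_sq.comp_mul_left' hj).add
    (integrable_inv_one_add_sq.comp_mul_left' hk)).div_const 2)
    (continuous_simplexChar_ofReal u).aestronglyMeasurable (ae_of_all _ fun t => ?_)
  exact norm_simplexChar_ofReal_le u hjk t

lemma integral_simplexChar_im (u : ι → ℝ) : (∫ t : ℝ, simplexChar u t).im = 0 := by
  rw [← conj_eq_iff_im, ← integral_conj, ← integral_neg_eq_self]
  exact integral_congr_ae (ae_of_all _ fun t => by simp only [simplexChar_neg, conj_conj])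

lemma integral_simplexChar_re {u : ι → ℝ} (hint : Integrable fun t : ℝ => simplexChar u t) :
    (∫ t : ℝ, simplexChar u t).re = 2 * ∫ t in Set.Ioi (0 : ℝ), (simplexChar u t).re := by
  have h1 : (∫ t : ℝ, simplexChar u t).re = ∫ t : ℝ, (simplexChar u t).re :=
    (reCLM.integral_comp_comm hint).symm
  rw [h1, ← integral_comp_abs (f := fun t : ℝ => (simplexChar u t).re)]
  refine integral_congr_ae (ae_of_all _ fun t => ?_)
  rcases abs_choice t with h | h
  · simp only [h]
  · simp only [h, simplexChar_neg, conj_re]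

/-- The real part of `∫_0^∞` as the limit of proper integrals. -/
lemma tendsto_integral_simplexChar_re {u : ι → ℝ}
    (hint : Integrable fun t : ℝ => simplexChar u t) :
    Tendsto (fun S : ℝ => 2 * (∫ t in (0 : ℝ)..S, simplexChar u t).re) atTop
      (𝓝 (∫ t : ℝ, simplexChar u t).re) := by
  have h := intervalIntegral_tendsto_integral_Ioi 0 hint.integrableOn tendsto_id
  rw [integral_simplexChar_re hint]
  have h2 : (∫ t in Set.Ioi (0 : ℝ), simplexChar u t).re =
      ∫ t in Set.Ioi (0 : ℝ), (simplexChar u t).re :=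
    (reCLM.integral_comp_comm hint.integrableOn).symm
  rw [← h2]
  exact ((continuous_re.tendsto _).comp h).const_mul 2

end Integrand

section Contour

open Complex Filter Topology ComplexConjugate

variable {ι : Type*} [Fintype ι]

lemma mem_ball_ofReal_iff {R : ℝ} {z : ℂ} :
    z ∈ Metric.ball (R : ℂ) √(R ^ 2 + 1) ↔ z.re ^ 2 + z.im ^ 2 < 2 * R * z.re + 1 := by
  rw [Metric.mem_ball, dist_eq, Real.lt_sqrt (norm_nonneg _), ← normSq_eq_norm_sq, normSq_apply,
    sub_re, sub_im, ofReal_re, ofReal_im]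
  constructor <;> intro h <;> linarith

lemma one_add_ne_zero_of_mem_ball {u R : ℝ} (hu : |u| ≤ 1) {z : ℂ}
    (hz : z ∈ Metric.ball (R : ℂ) √(R ^ 2 + 1)) : 1 + I * u * z ≠ 0 := by
  rw [mem_ball_ofReal_iff] at hz
  intro h
  have h1 := one_add_re u z
  have h2 := one_add_im u z
  rw [h, zero_re] at h1
  rw [h, zero_im] at h2
  have hu2 : u ^ 2 ≤ 1 := by simpa using (sq_le_one_iff_abs_le_one u).2 hu
  rcases mul_eq_zero.1 h2.symm with h3 | h3
  · rw [h3] at h1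
    norm_num at h1
  · rw [h3] at hz
    have h4 : u * z.im = 1 := by linarith
    have h5 : u ^ 2 * z.im ^ 2 = 1 := by rw [← mul_pow, h4, one_pow]
    nlinarith [sq_nonneg z.im]

lemma exists_primitive_simplexChar {u : ι → ℝ} (hu : ∀ j, |u j| ≤ 1) (R : ℝ) :
    ∃ Φ : ℂ → ℂ, ∀ z ∈ Metric.ball (R : ℂ) √(R ^ 2 + 1), HasDerivAt Φ (simplexChar u z) z :=
  DifferentiableOn.isExactOn_ball fun _ hz => (differentiableAt_simplexChar
    fun j => one_add_ne_zero_of_mem_ball (hu j) hz).differentiableWithinAt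

lemma IsCompact.exists_subset_ball_ofReal {K : Set ℂ} (hK : IsCompact K)
    (h : ∀ z ∈ K, 0 < z.re ∨ z = 0) :
    ∃ R : ℝ, K ⊆ Metric.ball (R : ℂ) √(R ^ 2 + 1) := by
  let U : ℝ → Set ℂ := fun R => {z : ℂ | z.re ^ 2 + z.im ^ 2 < 2 * R * max z.re 0 + 1}
  have hcover : K ⊆ ⋃ R, U R := by
    intro z hz
    rw [Set.mem_iUnion]
    rcases h z hz with h | rfl
    · refine ⟨(z.re ^ 2 + z.im ^ 2) / (2 * z.re), ?_⟩
      change z.re ^ 2 + z.im ^ 2 < _ * max z.re 0 + 1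
      rw [max_eq_left h.le]
      field_simp
      linarith
    · exact ⟨0, by simp [U]⟩
  have hmono : Monotone U := fun R R' hRR z hz => by
    have h1 : z.re ^ 2 + z.im ^ 2 < 2 * R * max z.re 0 + 1 := hz
    have h2 := mul_le_mul_of_nonneg_right hRR (le_max_right z.re 0)
    change z.re ^ 2 + z.im ^ 2 < 2 * R' * max z.re 0 + 1
    linarith
  obtain ⟨R, hR⟩ := hK.elim_directed_cover U
    (fun R => isOpen_lt (by fun_prop) (by fun_prop)) hcover hmono.directed_le
  refine ⟨R, fun z hz => mem_ball_ofReal_iff.2 ?_⟩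
  have h1 : z.re ^ 2 + z.im ^ 2 < 2 * R * max z.re 0 + 1 := hR hz
  have h2 : 0 ≤ z.re := by
    rcases h z hz with h | rfl
    · exact h.le
    · exact zero_re.ge
  rwa [max_eq_left h2] at h1

lemma hasDerivAt_arctan_vertical {u S : ℝ} (hu : u ≠ 0) (hS : 0 < S) (r : ℝ) :
    HasDerivAt (fun r : ℝ => (u ^ 2 * S)⁻¹ * Real.arctan ((u * r - 1) / (u * S)))
      (‖1 + I * u * ((S : ℂ) + r * I)‖ ^ 2)⁻¹ r := by
  have h1 : HasDerivAt (fun r : ℝ => (u * r - 1) / (u * S)) (u * 1 / (u * S)) r :=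
    (((hasDerivAt_id' r).const_mul u).sub_const 1).div_const _
  refine (h1.arctan.const_mul _).congr_deriv ?_
  rw [norm_sq_one_add, vertical_re, vertical_im]
  have h2 : (1 - u * r) ^ 2 + (u * S) ^ 2 ≠ 0 := by positivity
  have h3 : 1 + ((u * r - 1) / (u * S)) ^ 2 ≠ 0 := by positivity
  have h4 : (1 - u * r) ^ 2 + (u * S) ^ 2 = (u * S) ^ 2 * (1 + ((u * r - 1) / (u * S)) ^ 2) := by
    field_simp
    ring
  rw [h4]
  field_simp

lemma one_le_norm_one_add {u S : ℝ} (hS : u ≠ 0 → |u|⁻¹ ≤ S) (r : ℝ) :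
    1 ≤ ‖1 + I * u * ((S : ℂ) + r * I)‖ := by
  rcases eq_or_ne u 0 with rfl | hu
  · simp
  · refine le_trans ?_ (abs_im_le_norm _)
    have h0 : 0 < |u| := abs_pos.2 hu
    rw [one_add_im, vertical_re, abs_mul]
    have h1 : |u|⁻¹ ≤ |S| := (hS hu).trans (le_abs_self S)
    calc 1 = |u| * |u|⁻¹ := (mul_inv_cancel₀ h0.ne').symm
      _ ≤ _ := by gcongr

/-- On a vertical segment far to the right, a primitive of `simplexChar u` varies little. -/
lemma norm_primitive_vertical_sub_le {u : ι → ℝ} (hsum : ∑ j, u j = 0) {j k : ι} (hjk : j ≠ k)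
    (hj : u j ≠ 0) (hk : u k ≠ 0) {S : ℝ} (hS0 : 0 < S) (hS : ∀ i, u i ≠ 0 → |u i|⁻¹ ≤ S)
    {Φ : ℂ → ℂ} {τ : ℝ} (hΦ : ∀ r ∈ Set.uIcc 0 τ,
      HasDerivAt Φ (simplexChar u ((S : ℂ) + r * I)) ((S : ℂ) + r * I)) :
    ‖Φ ((S : ℂ) + τ * I) - Φ S‖ ≤ ((u j ^ 2)⁻¹ + (u k ^ 2)⁻¹) * Real.pi / 2 / S := by
  have hne : ∀ (i : ι) (r : ℝ), 1 + I * u i * ((S : ℂ) + r * I) ≠ 0 := fun i r =>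
    norm_pos_iff.1 (one_pos.trans_le (one_le_norm_one_add (hS i) r))
  have hcont : Continuous fun r : ℝ => simplexChar u ((S : ℂ) + r * I) * I := by
    refine Continuous.mul (continuous_iff_continuousAt.2 fun r => ?_) continuous_const
    exact ContinuousAt.comp (g := simplexChar u)
      (differentiableAt_simplexChar fun j => hne j r).continuousAt
      (hasDerivAt_vertical S r).continuousAt
  have hinv : ∀ i, Continuous fun r : ℝ => (‖1 + I * u i * ((S : ℂ) + r * I)‖ ^ 2)⁻¹ := fun i =>
    Continuous.inv₀ (by fun_prop) fun r => pow_ne_zero 2 (norm_ne_zero_iff.2 (hne i r))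
  have hint := intervalIntegral.integral_eq_sub_of_hasDerivAt
    (fun r hr => HasDerivAt.comp (h := fun x : ℝ => (S : ℂ) + x * I) r (hΦ r hr)
      (hasDerivAt_vertical S r)) (hcont.intervalIntegrable 0 τ)
  have hint' := intervalIntegral.integral_eq_sub_of_hasDerivAt (a := 0) (b := τ)
    (fun r _ => ((hasDerivAt_arctan_vertical hj hS0 r).fun_add
      (hasDerivAt_arctan_vertical hk hS0 r)).div_const 2)
    (((hinv j).add (hinv k)).div_const 2 |>.intervalIntegrable 0 τ)
  have hle := intervalIntegral.norm_integral_le_abs_of_norm_le (a := 0) (b := τ) (μ := volume)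
    (f := fun r : ℝ => simplexChar u ((S : ℂ) + r * I) * I)
    (g := fun r : ℝ => ((‖1 + I * u j * ((S : ℂ) + r * I)‖ ^ 2)⁻¹ +
      (‖1 + I * u k * ((S : ℂ) + r * I)‖ ^ 2)⁻¹) / 2)
    (ae_of_all _ fun r => by
      rw [norm_mul, norm_I, mul_one, norm_simplexChar, hsum, zero_mul, neg_zero, Real.exp_zero,
        one_mul]
      exact Finset.prod_inv_le_add_inv_sq_div_two (fun i => one_le_norm_one_add (hS i) r) hjk)
    (((hinv j).add (hinv k)).div_const 2 |>.intervalIntegrable 0 τ)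
  rw [hint, hint'] at hle
  simp only [Function.comp_apply, ofReal_zero, zero_mul, add_zero] at hle
  refine hle.trans ?_
  have harc : ∀ v : ℝ, v ≠ 0 → |(v ^ 2 * S)⁻¹ * Real.arctan ((v * τ - 1) / (v * S)) -
      (v ^ 2 * S)⁻¹ * Real.arctan ((v * 0 - 1) / (v * S))| ≤ (v ^ 2 * S)⁻¹ * Real.pi := by
    intro v hv
    have hpos : 0 < (v ^ 2 * S)⁻¹ := by positivity
    rw [← mul_sub, abs_mul, abs_of_pos hpos]
    gcongr
    rw [abs_le]
    constructor <;>
    linarith [Real.arctan_lt_pi_div_two ((v * τ - 1) / (v * S)),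
      Real.neg_pi_div_two_lt_arctan ((v * τ - 1) / (v * S)),
      Real.arctan_lt_pi_div_two ((v * 0 - 1) / (v * S)),
      Real.neg_pi_div_two_lt_arctan ((v * 0 - 1) / (v * S))]
  have h1 := abs_le.1 (harc _ hj)
  have h2 := abs_le.1 (harc _ hk)
  have h3 : ((u j ^ 2)⁻¹ + (u k ^ 2)⁻¹) * Real.pi / 2 / S =
      ((u j ^ 2 * S)⁻¹ * Real.pi + (u k ^ 2 * S)⁻¹ * Real.pi) / 2 := by
    rw [mul_inv, mul_inv]
    ring
  rw [h3, abs_le]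
  constructor <;> linarith [h1.1, h1.2, h2.1, h2.2]

end Contour

section RealContour

open Complex Filter Topology ComplexConjugate

variable {ι : Type*} [Fintype ι]

lemma simplexChar_eq_exp_re_phase {u : ι → ℝ} {t : ℂ} (ht : 0 < t.re) (him : (phase u t).im = 0) :
    simplexChar u t = (Real.exp (phase u t).re : ℝ) := by
  rw [simplexChar, ← exp_phase u (.inl ht), ofReal_exp]
  congr 1
  exact Complex.ext rfl (by rw [him, ofReal_im])

namespace IsRealContour

variable {u : ι → ℝ} {τ : ℝ → ℝ}

lemma hasDerivAt_re_primitive (hτ : IsRealContour u τ) (hu : ∑ j, u j ^ 2 = 1) {Φ : ℂ → ℂ} {s : ℝ}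
    (hs : 0 < s) (hΦ : HasDerivAt Φ (simplexChar u ((s : ℂ) + τ s * I)) ((s : ℂ) + τ s * I)) :
    HasDerivAt (fun x : ℝ => (Φ ((x : ℂ) + τ x * I)).re)
      (Real.exp (phase u ((s : ℂ) + τ s * I)).re) s := by
  have h := (HasDerivAt.comp (h := fun x : ℝ => (x : ℂ) + τ x * I) s hΦ
    (hasDerivAt_path (hτ.differentiableAt hu hs).hasDerivAt)).complex_re
  refine h.congr_deriv ?_
  rw [simplexChar_eq_exp_re_phase ((vertical_re s (τ s)).symm ▸ hs) (hτ.im_eq_zero s hs),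
    re_ofReal_mul]
  simp

/-- Along the real contour, a primitive of `simplexChar u` grows by at least `π / e`. -/
lemma pi_le_exp_one_mul_re_primitive_sub (hτ : IsRealContour u τ) (hu : ∑ j, u j ^ 2 = 1)
    {S : ℝ} (hS : Real.pi ≤ S) {Φ : ℂ → ℂ}
    (hΦ : ∀ s ∈ Set.Icc 0 S,
      HasDerivAt Φ (simplexChar u ((s : ℂ) + τ s * I)) ((s : ℂ) + τ s * I)) :
    Real.pi ≤ Real.exp 1 * ((Φ ((S : ℂ) + τ S * I)).re - (Φ 0).re) := by
  obtain ⟨Q, hQ, hQ0, hQpi⟩ := exists_primitive_extremal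
  set G : ℝ → ℝ := fun x => (Φ ((x : ℂ) + τ x * I)).re with hG
  have hGd : ∀ s, 0 < s → s ≤ S → HasDerivAt G (Real.exp (phase u ((s : ℂ) + τ s * I)).re) s :=
    fun s hs hsS => hτ.hasDerivAt_re_primitive hu hs (hΦ s ⟨hs.le, hsS⟩)
  have hGmono : MonotoneOn G (Set.Ioc 0 S) := by
    refine monotoneOn_of_deriv_nonneg (convex_Ioc _ _)
      (fun x hx => (hGd x hx.1 hx.2).continuousAt.continuousWithinAt) ?_ ?_ <;>
    rw [interior_Ioc]
    · exact fun x hx => (hGd x hx.1 hx.2.le).differentiableAt.differentiableWithinAt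
    · intro x hx
      rw [(hGd x hx.1 hx.2.le).deriv]
      exact (Real.exp_pos _).le
  have hDd : ∀ s ∈ Set.Ioo 0 Real.pi, HasDerivAt (fun s => Real.exp 1 * G s - Q s)
      (Real.exp 1 * Real.exp (phase u ((s : ℂ) + τ s * I)).re -
        Real.exp (s * Real.cos s / Real.sin s) * (Real.sin s / s)) s := fun s hs =>
    ((hGd s hs.1 (hs.2.le.trans hS)).const_mul _).fun_sub (hQ s hs.1 hs.2)
  have hDmono : MonotoneOn (fun s => Real.exp 1 * G s - Q s) (Set.Ioo 0 Real.pi) := by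
    refine monotoneOn_of_deriv_nonneg (convex_Ioo _ _)
      (fun x hx => (hDd x hx).continuousAt.continuousWithinAt) ?_ ?_ <;>
    rw [interior_Ioo]
    · exact fun x hx => (hDd x hx).differentiableAt.differentiableWithinAt
    · intro x hx
      rw [(hDd x hx).deriv, sub_nonneg, ← Real.exp_add,
        ← Real.exp_log (div_pos (Real.sin_pos_of_pos_of_lt_pi hx.1 hx.2) hx.1), ← Real.exp_add,
        Real.exp_le_exp]
      linarith [hτ.le_re_phase hu hx.1 hx.2]
  have hG0 : Tendsto G (𝓝[>] 0) (𝓝 (Φ 0).re) := by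
    have h0 := hΦ 0 ⟨le_rfl, Real.pi_pos.le.trans hS⟩
    rw [hτ.zero, ofReal_zero, zero_mul, add_zero] at h0
    exact (continuous_re.tendsto _).comp (h0.continuousAt.tendsto.comp (hτ.tendsto_path_zero hu))
  have hle : ∀ s ∈ Set.Ioo 0 Real.pi, Real.exp 1 * (Φ 0).re + Q s ≤ Real.exp 1 * G S := by
    intro s hs
    have h1 : Real.exp 1 * (Φ 0).re - 0 ≤ Real.exp 1 * G s - Q s := by
      refine le_of_tendsto ((hG0.const_mul _).sub hQ0) ?_
      filter_upwards [Ioo_mem_nhdsGT hs.1] with x hx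
      exact hDmono ⟨hx.1, hx.2.trans hs.2⟩ hs hx.2.le
    have h2 : G s ≤ G S := hGmono ⟨hs.1, hs.2.le.trans hS⟩ ⟨Real.pi_pos.trans_le hS, le_rfl⟩
      (hs.2.le.trans hS)
    have h3 := mul_le_mul_of_nonneg_left h2 (Real.exp_pos 1).le
    linarith
  have hlim := le_of_tendsto (hQpi.const_add (Real.exp 1 * (Φ 0).re))
    (by filter_upwards [Ioo_mem_nhdsLT Real.pi_pos] with s hs using hle s hs)
  rw [mul_sub]
  linarith

lemma pi_div_exp_one_le_integral (hτ : IsRealContour u τ) (hu : ∑ j, u j ^ 2 = 1)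
    (hsum : ∑ j, u j = 0) {j k : ι} (hjk : j ≠ k) (hj : u j ≠ 0) (hk : u k ≠ 0) {S : ℝ}
    (hS : Real.pi ≤ S) (hS' : ∀ i, u i ≠ 0 → |u i|⁻¹ ≤ S) :
    Real.pi / Real.exp 1 - ((u j ^ 2)⁻¹ + (u k ^ 2)⁻¹) * Real.pi / 2 / S ≤
      (∫ t in (0 : ℝ)..S, simplexChar u t).re := by
  have hS0 : 0 < S := Real.pi_pos.trans_le hS
  have hK : IsCompact (insert (S : ℂ) ((fun s : ℝ => (s : ℂ) + τ s * I) '' Set.Icc 0 S)) :=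
    (isCompact_Icc.image_of_continuousOn
      ((hτ.continuousOn_path hu).mono Set.Icc_subset_Ici_self)).insert _
  obtain ⟨R, hR⟩ := hK.exists_subset_ball_ofReal (by
    rintro z (rfl | ⟨s, hs, rfl⟩)
    · exact .inl hS0
    · rcases eq_or_lt_of_le hs.1 with rfl | h
      · exact .inr (by simp [hτ.zero])
      · exact .inl ((vertical_re s (τ s)).symm ▸ h))
  obtain ⟨Φ, hΦ⟩ := exists_primitive_simplexChar (abs_le_one_of_sum_sq hu) R
  have hpath : ∀ s ∈ Set.Icc 0 S,
      (s : ℂ) + τ s * I ∈ Metric.ball (R : ℂ) √(R ^ 2 + 1) := fun s hs =>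
    hR (.inr ⟨s, hs, rfl⟩)
  have hSR : (S : ℂ) ∈ Metric.ball (R : ℂ) √(R ^ 2 + 1) := hR (.inl rfl)
  have hreal : ∀ s ∈ Set.uIcc 0 S, (s : ℂ) ∈ Metric.ball (R : ℂ) √(R ^ 2 + 1) := by
    intro s hs
    rw [Set.uIcc_of_le hS0.le] at hs
    rw [mem_ball_ofReal_iff, ofReal_re, ofReal_im] at hSR ⊢
    rcases eq_or_lt_of_le hs.2 with rfl | hlt
    · exact hSR
    · nlinarith [mul_le_mul_of_nonneg_left hSR.le hs.1, mul_nonneg hs.1 (sub_nonneg.2 hs.2)]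
  have hvert : ∀ r ∈ Set.uIcc 0 (τ S),
      (S : ℂ) + r * I ∈ Metric.ball (R : ℂ) √(R ^ 2 + 1) := by
    intro r hr
    have h := hpath S ⟨hS0.le, le_rfl⟩
    rw [mem_ball_ofReal_iff, vertical_re, vertical_im] at h ⊢
    have : r ^ 2 ≤ τ S ^ 2 := by
      refine sq_le_sq.2 ?_
      simpa using Set.abs_sub_left_of_mem_uIcc hr
    linarith
  have hint := intervalIntegral.integral_eq_sub_of_hasDerivAt
    (fun s hs => (hΦ _ (hreal s hs)).comp_ofReal)
    ((continuous_simplexChar_ofReal u).intervalIntegrable 0 S)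
  have hgrow := hτ.pi_le_exp_one_mul_re_primitive_sub hu hS fun s hs => hΦ _ (hpath s hs)
  have htail := norm_primitive_vertical_sub_le hsum hjk hj hk hS0 hS'
    fun r hr => hΦ _ (hvert r hr)
  have htail' := (re_le_norm _).trans htail
  rw [sub_re] at htail'
  rw [hint, sub_re, ofReal_zero]
  have : Real.pi / Real.exp 1 ≤ (Φ ((S : ℂ) + τ S * I)).re - (Φ 0).re := by
    rw [div_le_iff₀ (Real.exp_pos 1)]
    linarith
  linarith

end IsRealContour

lemma two_pi_div_exp_one_le_integral {u : ι → ℝ} (hu : ∑ j, u j ^ 2 = 1) (hsum : ∑ j, u j = 0)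
    {j k : ι} (hjk : j ≠ k) (hj : u j ≠ 0) (hk : u k ≠ 0) :
    2 * (Real.pi / Real.exp 1) ≤ (∫ t : ℝ, simplexChar u t).re := by
  obtain ⟨τ, hτ⟩ := exists_isRealContour hu hsum
  have hlim := (tendsto_const_nhds (x := ((u j ^ 2)⁻¹ + (u k ^ 2)⁻¹) * Real.pi / 2)).div_atTop
    (tendsto_id (α := ℝ) (x := atTop))
  have hlim' := (hlim.const_sub (Real.pi / Real.exp 1)).const_mul 2
  rw [sub_zero] at hlim'
  refine le_of_tendsto_of_tendsto hlim'
    (tendsto_integral_simplexChar_re (integrable_simplexChar hjk hj hk)) ?_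
  have hev : ∀ᶠ S : ℝ in atTop, ∀ i, u i ≠ 0 → |u i|⁻¹ ≤ S :=
    eventually_all.2 fun i => (eventually_ge_atTop _).mono fun S hS _ => hS
  filter_upwards [hev, eventually_ge_atTop Real.pi] with S hS1 hS2
  exact mul_le_mul_of_nonneg_left
    (hτ.pi_div_exp_one_le_integral hu hsum hjk hj hk hS2 hS1) zero_le_two

/-- The previous bound without the normalization of the sum of squares. -/
lemma two_pi_div_exp_one_le_sqrt_mul_integral {u : ι → ℝ} (hsum : ∑ j, u j = 0)
    {j k : ι} (hjk : j ≠ k) (hj : u j ≠ 0) (hk : u k ≠ 0) :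
    2 * (Real.pi / Real.exp 1) ≤ √(∑ j, u j ^ 2) * (∫ t : ℝ, simplexChar u t).re := by
  have hpos : 0 < ∑ i, u i ^ 2 :=
    Finset.sum_pos' (fun i _ => sq_nonneg _) ⟨j, Finset.mem_univ j, by positivity⟩
  set c := √(∑ i, u i ^ 2) with hc
  have hc0 : 0 < c := Real.sqrt_pos.2 hpos
  have h := two_pi_div_exp_one_le_integral (u := fun i => c⁻¹ * u i) (j := j) (k := k)
    (by
      simp only [mul_pow]
      rw [← Finset.mul_sum, ← Real.sq_sqrt hpos.le, ← hc, inv_pow,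
        inv_mul_cancel₀ (pow_ne_zero 2 hc0.ne')])
    (by rw [← Finset.mul_sum, hsum, mul_zero]) hjk (by positivity) (by positivity)
  refine h.trans_eq ?_
  have hscale : ∀ t : ℝ, simplexChar (fun i => c⁻¹ * u i) t = simplexChar u ((c⁻¹ * t : ℝ) : ℂ) := by
    intro t
    unfold simplexChar
    refine Finset.prod_congr rfl fun i _ => ?_
    have : I * ((c⁻¹ * u i : ℝ) : ℂ) * t = I * u i * ((c⁻¹ * t : ℝ) : ℂ) := by
      push_cast
      ring
    rw [this]
  simp only [hscale]
  rw [Measure.integral_comp_mul_left (fun t : ℝ => simplexChar u t) c⁻¹, inv_inv,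
    abs_of_pos hc0, real_smul, re_ofReal_mul]

end RealContour

section Limit

open Complex Filter Topology

variable {ι : Type*} [Fintype ι]

/-- Append `M` equal coordinates to `u` so that the coordinates sum to zero. -/
noncomputable def balanced (u : ι → ℝ) (M : ℕ) : ι ⊕ Fin M → ℝ :=
  Sum.elim u fun _ => -((∑ j, u j) / M)

lemma sum_balanced (u : ι → ℝ) {M : ℕ} (hM : M ≠ 0) : ∑ j, balanced u M j = 0 := by
  have hM' : (M : ℝ) ≠ 0 := Nat.cast_ne_zero.2 hM
  simp only [balanced, Fintype.sum_sum_type, Sum.elim_inl, Sum.elim_inr, Finset.sum_const,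
    Finset.card_univ, Fintype.card_fin, nsmul_eq_mul]
  field_simp
  ring

lemma sum_sq_balanced (u : ι → ℝ) (M : ℕ) :
    ∑ j, balanced u M j ^ 2 = ∑ j, u j ^ 2 + (∑ j, u j) ^ 2 / M := by
  simp only [balanced, Fintype.sum_sum_type, Sum.elim_inl, Sum.elim_inr, Finset.sum_const,
    Finset.card_univ, Fintype.card_fin, nsmul_eq_mul]
  rcases eq_or_ne M 0 with rfl | hM
  · simp
  · have hM' : (M : ℝ) ≠ 0 := Nat.cast_ne_zero.2 hM
    field_simp

lemma simplexChar_balanced (u : ι → ℝ) (M : ℕ) (t : ℂ) :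
    simplexChar (balanced u M) t = simplexChar u t *
      (exp (I * (-((∑ j, u j) / M) : ℝ) * t) / (1 + I * (-((∑ j, u j) / M) : ℝ) * t)) ^ M := by
  simp only [simplexChar, balanced, Fintype.prod_sum_type, Sum.elim_inl, Sum.elim_inr,
    Finset.prod_const, Finset.card_univ, Fintype.card_fin]

lemma norm_simplexChar_balanced_le (u : ι → ℝ) (M : ℕ) (t : ℝ) :
    ‖simplexChar (balanced u M) t‖ ≤ ‖simplexChar u t‖ := by
  rw [simplexChar_balanced, norm_mul, norm_pow, norm_div]
  refine mul_le_of_le_one_right (norm_nonneg _) (pow_le_one₀ (by positivity) ?_)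
  refine div_le_one_of_le₀ (le_trans (le_of_eq ?_) (one_le_norm_one_add_ofReal _ t))
    (norm_nonneg _)
  rw [norm_exp]
  simp

lemma tendsto_simplexChar_balanced (u : ι → ℝ) (t : ℂ) :
    Tendsto (fun M : ℕ => simplexChar (balanced u M) t) atTop (𝓝 (simplexChar u t)) := by
  set w : ℂ := -(I * (∑ j, u j : ℝ) * t) with hw
  have h : Tendsto (fun M : ℕ => exp w / (1 + w / M) ^ M) atTop (𝓝 1) := by
    have := (tendsto_const_nhds (x := exp w)).div (tendsto_one_add_div_pow_exp w) (exp_ne_zero w)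
    rwa [div_self (exp_ne_zero w)] at this
  have h' := h.const_mul (simplexChar u t)
  rw [mul_one] at h'
  refine h'.congr' ?_
  filter_upwards [eventually_ne_atTop 0] with M hM
  have hM' : (M : ℂ) ≠ 0 := Nat.cast_ne_zero.2 hM
  have harg : I * (-((∑ j, u j) / M) : ℝ) * t = w / M := by
    rw [hw, ofReal_neg, ofReal_div, ofReal_natCast]
    ring
  rw [simplexChar_balanced, harg, div_pow, ← exp_nat_mul, mul_div_cancel₀ _ hM']

lemma two_pi_div_exp_one_le_integral_of_sum_sq {u : ι → ℝ} (hu : ∑ j, u j ^ 2 = 1)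
    {j k : ι} (hjk : j ≠ k) (hj : u j ≠ 0) (hk : u k ≠ 0) :
    2 * (Real.pi / Real.exp 1) ≤ (∫ t : ℝ, simplexChar u t).re := by
  have hint := integrable_simplexChar hjk hj hk
  have h1 : Tendsto (fun M : ℕ => ∫ t : ℝ, simplexChar (balanced u M) t) atTop
      (𝓝 (∫ t : ℝ, simplexChar u t)) :=
    tendsto_integral_of_dominated_convergence (fun t : ℝ => ‖simplexChar u t‖)
      (fun M => (continuous_simplexChar_ofReal _).aestronglyMeasurable) hint.norm
      (fun M => ae_of_all _ fun t => norm_simplexChar_balanced_le u M t)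
      (ae_of_all _ fun t => tendsto_simplexChar_balanced u t)
  have h2 : Tendsto (fun M : ℕ => √(∑ j, balanced u M j ^ 2)) atTop (𝓝 1) := by
    simp only [sum_sq_balanced, hu]
    have := (tendsto_const_div_atTop_nhds_zero_nat ((∑ j, u j) ^ 2)).const_add 1
    rw [add_zero] at this
    have h := (Real.continuous_sqrt.tendsto _).comp this
    rwa [Real.sqrt_one] at h
  have h3 := h2.mul ((continuous_re.tendsto _).comp h1)
  rw [one_mul] at h3
  refine ge_of_tendsto h3 ?_
  filter_upwards [eventually_ne_atTop 0] with M hM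
  exact two_pi_div_exp_one_le_sqrt_mul_integral (sum_balanced u hM)
    (j := Sum.inl j) (k := Sum.inl k) (by simpa using hjk) hj hk

end Limit

theorem stmt5 (n : ℕ) (u : Fin (n + 1) → ℝ) (hu : ∑ j, (u j) ^ 2 = 1)
    (htwo : ∃ j k, j ≠ k ∧ u j ≠ 0 ∧ u k ≠ 0) :
    Integrable (fun t : ℝ => Fchar u t) ∧
    (∫ t : ℝ, Fchar u t).im = 0 ∧
    (1 / (2 * Real.pi)) * (∫ t : ℝ, Fchar u t).re ≥ 1 / Real.exp 1 := by
  obtain ⟨j, k, hjk, hj, hk⟩ := htwo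
  refine ⟨integrable_simplexChar hjk hj hk, integral_simplexChar_im u, ?_⟩
  have h : 2 * (Real.pi / Real.exp 1) ≤ (∫ t : ℝ, Fchar u t).re :=
    two_pi_div_exp_one_le_integral_of_sum_sq hu hjk hj hk
  calc 1 / Real.exp 1 = 1 / (2 * Real.pi) * (2 * (Real.pi / Real.exp 1)) := by
        field_simp
    _ ≤ _ := by gcongr
end
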